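/- Assume the null hypothesis H₀: Σ¹²(r) = 0 for all r ∈ (0,1]. Set δ_T = T^{−1/2} Σ_{t=1}^{T} ϑ_t, Ω̂_st = (T^{−1} Σ_{t=1}^{T} u_{2t} u_{2t}ᵀ) ⊗ (T^{−1} Σ_{t=1}^{T} u_{1t} u_{1t}ᵀ), and S_st = δ_Tᵀ Ω̂_st^{−1} δ_T (defined arbitrarily on the event where Ω̂_st is singular, an event whose probability tends to 0). Then, as T → ∞, S_st converges in distribution to the law of Σ_{j=1}^{d₁d₂} λ_j Z_j², where Z₁, …, Z_{d₁d₂} are independent standard normal random variables and λ₁, …, λ_{d₁d₂} are the eigenvalues of Ω_st^{−1/2} Ω Ω_st^{−1/2}, with Ω_st = (∫₀¹ Σ²²(r) dr) ⊗ (∫₀¹ Σ¹¹(r) dr) and Ω = ∫₀¹ (G₂(r) ⊗ G₁(r)) M (G₂(r) ⊗ G₁(r))ᵀ dr. -/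

import Mathlib

open MeasureTheory ProbabilityTheory Matrix Filter
open scoped Kronecker NNReal Topology

noncomputable section

/-- A function satisfies a Lipschitz condition piecewise on a finite number of
sub-intervals partitioning `(0,1]`. -/
def PiecewiseLipschitz (f : ℝ → ℝ) : Prop :=
  ∃ (n : ℕ) (a : Fin (n + 1) → ℝ), a 0 = 0 ∧ a (Fin.last n) = 1 ∧ StrictMono a ∧
    ∀ i : Fin n, ∃ K : ℝ≥0, LipschitzOnWith K f (Set.Ioc (a i.castSucc) (a i.succ))

/-- Euclidean norm of a finitely indexed real vector. -/
def euclNorm {ι : Type*} [Fintype ι] (x : ι → ℝ) : ℝ := Real.sqrt (∑ i, x i ^ 2)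

/-- The standard Gaussian measure on `ι → ℝ` (iid standard normal coordinates). -/
def stdGaussianPi (ι : Type*) [Fintype ι] : Measure (ι → ℝ) :=
  Measure.pi fun _ => gaussianReal 0 1

/-- Convergence in distribution (weak convergence of the laws). -/
def TendstoInDistribution {Ω' : Type*} [MeasurableSpace Ω'] (P : Measure Ω')
    {E : Type*} [TopologicalSpace E] [MeasurableSpace E]
    (X : ℕ → Ω' → E) (μ : Measure E) : Prop :=
  ∀ f : BoundedContinuousFunction E ℝ,
    Tendsto (fun T => ∫ ω, f (X T ω) ∂P) atTop (𝓝 (∫ x, f x ∂μ))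

/-- `u_{kt} = G_k(t/T) ε_t`. -/
def uVec {k d : ℕ} (G : ℝ → Matrix (Fin k) (Fin d) ℝ) {Ω' : Type*}
    (ε : ℕ → Ω' → Fin d → ℝ) (T t : ℕ) (ω : Ω') : Fin k → ℝ :=
  (G ((t : ℝ) / T)).mulVec (ε t ω)

/-- `ϑ_t = u_{2t} ⊗ u_{1t}`. -/
def thetaSeq {d₁ d₂ : ℕ} (G₁ : ℝ → Matrix (Fin d₁) (Fin (d₁ + d₂)) ℝ)
    (G₂ : ℝ → Matrix (Fin d₂) (Fin (d₁ + d₂)) ℝ) {Ω' : Type*}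
    (ε : ℕ → Ω' → Fin (d₁ + d₂) → ℝ) (T t : ℕ) (ω : Ω') : Fin d₂ × Fin d₁ → ℝ :=
  fun p => uVec G₂ ε T t ω p.1 * uVec G₁ ε T t ω p.2

/-- `δ_T = T^{-1/2} Σ_{t=1}^T ϑ_t`. -/
def deltaStat {d₁ d₂ : ℕ} (G₁ : ℝ → Matrix (Fin d₁) (Fin (d₁ + d₂)) ℝ)
    (G₂ : ℝ → Matrix (Fin d₂) (Fin (d₁ + d₂)) ℝ) {Ω' : Type*}
    (ε : ℕ → Ω' → Fin (d₁ + d₂) → ℝ) (T : ℕ) (ω : Ω') : Fin d₂ × Fin d₁ → ℝ :=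
  (Real.sqrt T)⁻¹ • ∑ t ∈ Finset.Icc 1 T, thetaSeq G₁ G₂ ε T t ω

/-- `Ω̂_st = (T⁻¹ Σ u_{2t} u_{2t}ᵀ) ⊗ (T⁻¹ Σ u_{1t} u_{1t}ᵀ)`. -/
def OmHatSt {d₁ d₂ : ℕ} (G₁ : ℝ → Matrix (Fin d₁) (Fin (d₁ + d₂)) ℝ)
    (G₂ : ℝ → Matrix (Fin d₂) (Fin (d₁ + d₂)) ℝ) {Ω' : Type*}
    (ε : ℕ → Ω' → Fin (d₁ + d₂) → ℝ) (T : ℕ) (ω : Ω') :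
    Matrix (Fin d₂ × Fin d₁) (Fin d₂ × Fin d₁) ℝ :=
  ((T : ℝ)⁻¹ • ∑ t ∈ Finset.Icc 1 T, vecMulVec (uVec G₂ ε T t ω) (uVec G₂ ε T t ω)) ⊗ₖ
    ((T : ℝ)⁻¹ • ∑ t ∈ Finset.Icc 1 T, vecMulVec (uVec G₁ ε T t ω) (uVec G₁ ε T t ω))

/-- The standard Wald statistic `S_st = δ_Tᵀ Ω̂_st⁻¹ δ_T` (with the junk value of the
Lean matrix inverse on the event where `Ω̂_st` is singular). -/
def Sst {d₁ d₂ : ℕ} (G₁ : ℝ → Matrix (Fin d₁) (Fin (d₁ + d₂)) ℝ)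
    (G₂ : ℝ → Matrix (Fin d₂) (Fin (d₁ + d₂)) ℝ) {Ω' : Type*}
    (ε : ℕ → Ω' → Fin (d₁ + d₂) → ℝ) (T : ℕ) (ω : Ω') : ℝ :=
  deltaStat G₁ G₂ ε T ω ⬝ᵥ (OmHatSt G₁ G₂ ε T ω)⁻¹.mulVec (deltaStat G₁ G₂ ε T ω)

open scoped ComplexOrder in
/-- The positive semidefinite square root of a positive semidefinite matrix (the former
Mathlib definition, since removed). -/
def Matrix.PosSemidef.sqrt {n 𝕜 : Type*} [Fintype n] [RCLike 𝕜] [DecidableEq n]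
    {A : Matrix n n 𝕜} (hA : A.PosSemidef) : Matrix n n 𝕜 :=
  hA.1.eigenvectorUnitary.1 * diagonal ((↑) ∘ Real.sqrt ∘ hA.1.eigenvalues) *
    (star hA.1.eigenvectorUnitary : Matrix n n 𝕜)

/-- Bounded on `(0,1]` and continuous there outside a finite set. -/
def RNice (f : ℝ → ℝ) : Prop :=
  (∃ C : ℝ, ∀ r ∈ Set.Ioc (0 : ℝ) 1, |f r| ≤ C) ∧
    ∃ s : Set ℝ, s.Finite ∧ ∀ r ∈ Set.Ioc (0 : ℝ) 1, r ∉ s → ContinuousAt f r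

lemma RNice.const (c : ℝ) : RNice fun _ => c :=
  ⟨⟨|c|, fun _ _ => le_rfl⟩, ∅, Set.finite_empty, fun _ _ _ => continuousAt_const⟩

lemma RNice.add {f g : ℝ → ℝ} (hf : RNice f) (hg : RNice g) : RNice fun r => f r + g r := by
  obtain ⟨⟨C, hC⟩, s, hs, hs'⟩ := hf
  obtain ⟨⟨D, hD⟩, t, ht, ht'⟩ := hg
  refine ⟨⟨C + D, fun r hr => (abs_add_le _ _).trans (add_le_add (hC r hr) (hD r hr))⟩, s ∪ t,
    hs.union ht, fun r hr hn => ?_⟩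
  simp only [Set.mem_union, not_or] at hn
  exact (hs' r hr hn.1).add (ht' r hr hn.2)

lemma RNice.mul {f g : ℝ → ℝ} (hf : RNice f) (hg : RNice g) : RNice fun r => f r * g r := by
  obtain ⟨⟨C, hC⟩, s, hs, hs'⟩ := hf
  obtain ⟨⟨D, hD⟩, t, ht, ht'⟩ := hg
  refine ⟨⟨C * D, fun r hr => ?_⟩, s ∪ t,
    hs.union ht, fun r hr hn => ?_⟩
  · rw [abs_mul]
    exact mul_le_mul (hC r hr) (hD r hr) (abs_nonneg _) ((abs_nonneg _).trans (hC r hr))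
  simp only [Set.mem_union, not_or] at hn
  exact (hs' r hr hn.1).mul (ht' r hr hn.2)

lemma RNice.sum {ι : Type*} (s : Finset ι) {f : ι → ℝ → ℝ} (hf : ∀ i, RNice (f i)) :
    RNice fun r => ∑ i ∈ s, f i r := by
  classical
  induction s using Finset.induction_on with
  | empty => simpa using RNice.const 0
  | insert a s ha ih => simpa [Finset.sum_insert ha] using (hf a).add ih

lemma RNice.of_piecewise {f : ℝ → ℝ} (hb : ∃ C : ℝ, ∀ r ∈ Set.Ioc (0 : ℝ) 1, |f r| ≤ C)
    (hf : PiecewiseLipschitz f) : RNice f := by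
  refine ⟨hb, ?_⟩
  obtain ⟨n, a, h0, h1, hmono, hl⟩ := hf
  refine ⟨Set.range a, Set.finite_range a, fun r hr hn => ?_⟩
  have key : ∀ k : Fin (n + 1), r ≤ a k →
      ∃ i : Fin n, a i.castSucc < r ∧ r ≤ a i.succ := by
    intro k
    induction k using Fin.induction with
    | zero => intro h; rw [h0] at h; exact absurd hr.1 (not_lt.2 h)
    | succ i ih =>
      intro h
      by_cases hc : r ≤ a i.castSucc
      · exact ih hc
      · exact ⟨i, not_le.1 hc, h⟩
  obtain ⟨i, hi1, hi2⟩ := key (Fin.last n) (by rw [h1]; exact hr.2)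
  obtain ⟨K, hK⟩ := hl i
  have hi3 : r < a i.succ := lt_of_le_of_ne hi2 fun h => hn ⟨_, h.symm⟩
  exact hK.continuousOn.continuousAt (Ioc_mem_nhds hi1 hi3)

lemma RNice.integrableOn {f : ℝ → ℝ} (hf : RNice f) :
    IntegrableOn f (Set.Ioc (0 : ℝ) 1) := by
  obtain ⟨⟨C, hC⟩, s, hs, hs'⟩ := hf
  have h1 : AEStronglyMeasurable f (volume.restrict (Set.Ioc (0:ℝ) 1)) := by
    have h2 : ContinuousOn f (Set.Ioc (0:ℝ) 1 \ s) :=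
      fun r hr => (hs' r hr.1 hr.2).continuousWithinAt
    have h3 := h2.aestronglyMeasurable (μ := volume) (measurableSet_Ioc.diff hs.measurableSet)
    have h4 : (volume : Measure ℝ).restrict (Set.Ioc (0:ℝ) 1 \ s)
        = (volume : Measure ℝ).restrict (Set.Ioc (0:ℝ) 1) :=
      Measure.restrict_congr_set (sdiff_null_ae_eq_self (hs.measure_zero _))
    rwa [h4] at h3
  refine Integrable.mono' (integrable_const C) h1 ?_
  exact ae_restrict_of_forall_mem measurableSet_Ioc hC

lemma sum_Icc_one {M : Type*} [AddCommMonoid M] (f : ℕ → M) (T : ℕ) :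
    ∑ t ∈ Finset.Icc 1 T, f t = ∑ k ∈ Finset.range T, f (k + 1) := by
  induction T with
  | zero => simp
  | succ n ih => rw [Finset.sum_Icc_succ_top (by omega), ih, Finset.sum_range_succ]

lemma riemann_eq (f : ℝ → ℝ) (T : ℕ) (hT : 0 < T) :
    ∫ r in Set.Ioc (0 : ℝ) 1, f ((⌈r * T⌉₊ : ℝ) / T)
      = (T : ℝ)⁻¹ * ∑ t ∈ Finset.Icc 1 T, f ((t : ℝ) / T) := by
  have hT' : (0 : ℝ) < T := by exact_mod_cast hT
  set g : ℝ → ℝ := fun r => f ((⌈r * T⌉₊ : ℝ) / T) with hg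
  have hmem : ∀ k : ℕ, ∀ r ∈ Set.Ioc ((k : ℝ) / T) (((k + 1 : ℕ) : ℝ) / T),
      g r = f (((k + 1 : ℕ) : ℝ) / T) := by
    intro k r hr
    have : ⌈r * T⌉₊ = k + 1 := by
      rw [Nat.ceil_eq_iff (by omega)]
      constructor
      · have := hr.1; rw [div_lt_iff₀ hT'] at this; simpa using this
      · have := hr.2; rwa [le_div_iff₀ hT'] at this
    simp only [hg, this]
  have hIntg : ∀ k : ℕ, IntervalIntegrable g volume ((k : ℝ) / T) (((k + 1 : ℕ) : ℝ) / T) := by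
    intro k
    have hle : (k : ℝ) / T ≤ ((k + 1 : ℕ) : ℝ) / T := by gcongr; linarith
    rw [intervalIntegrable_iff_integrableOn_Ioc_of_le hle]
    exact IntegrableOn.congr_fun (integrableOn_const (C := f (((k + 1 : ℕ) : ℝ) / T)) (by simp))
      (fun r hr => (hmem k r hr).symm) measurableSet_Ioc
  have h1 := intervalIntegral.sum_integral_adjacent_intervals (n := T)
    (a := fun k : ℕ => (k : ℝ) / T) (f := g) (μ := volume) (fun k _ => hIntg k)
  simp only [Nat.cast_zero, zero_div, div_self hT'.ne'] at h1
  rw [intervalIntegral.integral_of_le zero_le_one] at h1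
  rw [← h1, Finset.mul_sum]
  rw [sum_Icc_one]
  refine Finset.sum_congr rfl fun k _ => ?_
  have hle : (k : ℝ) / T ≤ ((k + 1 : ℕ) : ℝ) / T := by gcongr; linarith
  rw [intervalIntegral.integral_of_le hle, setIntegral_congr_fun measurableSet_Ioc (hmem k)]
  simp only [integral_const, MeasurableSet.univ, measureReal_restrict_apply, Set.univ_inter,
    Real.volume_real_Ioc, smul_eq_mul]
  rw [max_eq_left (by linarith)]
  push_cast
  field_simp
  ring

lemma riemann_tendsto {f : ℝ → ℝ} (hf : RNice f) :
    Tendsto (fun T : ℕ => (T : ℝ)⁻¹ * ∑ t ∈ Finset.Icc 1 T, f ((t : ℝ) / T)) atTop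
      (𝓝 (∫ r in Set.Ioc (0 : ℝ) 1, f r)) := by
  have hmeasg : ∀ T : ℕ, Measurable fun r : ℝ => f ((⌈r * T⌉₊ : ℝ) / T) := by
    intro T
    have h1 : Measurable fun r : ℝ => ⌈r * T⌉₊ := by fun_prop
    exact (measurable_from_nat (f := fun n : ℕ => f ((n : ℝ) / T))).comp h1
  obtain ⟨⟨C, hC⟩, s, hs, hs'⟩ := hf
  have hlim : Tendsto (fun T : ℕ => ∫ r in Set.Ioc (0 : ℝ) 1, f ((⌈r * T⌉₊ : ℝ) / T)) atTop
      (𝓝 (∫ r in Set.Ioc (0 : ℝ) 1, f r)) := by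
    refine tendsto_integral_filter_of_dominated_convergence (fun _ => C) ?_ ?_
      (integrable_const C) ?_
    · exact Eventually.of_forall fun T => (hmeasg T).aestronglyMeasurable
    · filter_upwards [eventually_gt_atTop 0] with T hT
      have hT' : (0 : ℝ) < T := by exact_mod_cast hT
      refine ae_restrict_of_forall_mem measurableSet_Ioc fun r hr => hC _ ⟨?_, ?_⟩
      · have : 0 < ⌈r * T⌉₊ := Nat.ceil_pos.2 (mul_pos hr.1 hT')
        have : (0:ℝ) < ⌈r * T⌉₊ := by exact_mod_cast this
        positivity
      · rw [div_le_one hT']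
        have : ⌈r * T⌉₊ ≤ T := Nat.ceil_le.2 (by nlinarith [hr.2])
        exact_mod_cast this
    · have hae : ∀ᵐ r ∂(volume.restrict (Set.Ioc (0:ℝ) 1)), r ∉ s := by
        refine ae_restrict_of_ae ?_
        exact measure_eq_zero_iff_ae_notMem.1 (hs.measure_zero volume)
      filter_upwards [hae, ae_restrict_mem measurableSet_Ioc] with r hr1 hr2
      refine (hs' r hr2 hr1).tendsto.comp ?_
      exact (tendsto_nat_ceil_mul_div_atTop hr2.1.le).comp tendsto_natCast_atTop_atTop
  refine hlim.congr' ?_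
  filter_upwards [eventually_gt_atTop 0] with T hT
  exact riemann_eq f T hT

lemma integral_pull {Ω' : Type*} {m mΩ : MeasurableSpace Ω'} (hm : m ≤ mΩ) (P : Measure Ω')
    [IsProbabilityMeasure P] {f : Ω' → ℝ} {c : ℝ} (hf : Integrable f P)
    (hc : P[f|m] =ᵐ[P] fun _ => c) {g : Ω' → ℂ} (hg : StronglyMeasurable[m] g)
    (hb : ∀ ω, ‖g ω‖ ≤ 1) : ∫ ω, g ω * (f ω : ℂ) ∂P = c * ∫ ω, g ω ∂P := by
  have h := condExp_stronglyMeasurable_bilin_of_bound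
    ((ContinuousLinearMap.lsmul ℝ ℝ : ℝ →L[ℝ] ℂ →L[ℝ] ℂ).flip) hm hg hf 1
    (Eventually.of_forall hb)
  have h2 := integral_condExp (μ := P) hm
    (f := fun ω => ((ContinuousLinearMap.lsmul ℝ ℝ : ℝ →L[ℝ] ℂ →L[ℝ] ℂ).flip) (g ω) (f ω))
  rw [integral_congr_ae h] at h2
  have h3 : (fun ω => ((ContinuousLinearMap.lsmul ℝ ℝ : ℝ →L[ℝ] ℂ →L[ℝ] ℂ).flip) (g ω)
      ((P[f|m]) ω)) =ᵐ[P] fun ω => (c : ℂ) * g ω := by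
    filter_upwards [hc] with ω hω
    simp [hω]
  rw [integral_congr_ae h3, integral_const_mul] at h2
  rw [h2]
  refine integral_congr_ae (Eventually.of_forall fun ω => ?_)
  simp [mul_comm]

lemma integral_mul_zero {Ω' : Type*} {m mΩ : MeasurableSpace Ω'} (hm : m ≤ mΩ) (P : Measure Ω')
    [IsProbabilityMeasure P] {f g : Ω' → ℝ} (hf : Integrable f P)
    (hc : P[f|m] =ᵐ[P] fun _ => 0) (hg : StronglyMeasurable[m] g)
    (hfg : Integrable (g * f) P) : ∫ ω, g ω * f ω ∂P = 0 := by
  have h := condExp_mul_of_stronglyMeasurable_left hg hfg hf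
  have h2 := integral_condExp (μ := P) hm (f := g * f)
  rw [integral_congr_ae h] at h2
  have h3 : g * P[f|m] =ᵐ[P] fun _ => (0 : ℝ) := by
    filter_upwards [hc] with ω hω
    simp [hω]
  rw [integral_congr_ae h3] at h2
  simpa using h2.symm

lemma mds_sq_bound {Ω' : Type*} {mΩ : MeasurableSpace Ω'} (P : Measure Ω')
    [IsProbabilityMeasure P] (F : Filtration ℕ mΩ) (x : ℕ → Ω' → ℝ) (K : ℝ) (T : ℕ)
    (hx : ∀ k < T, StronglyMeasurable[F (k + 1)] (x k))
    (h2 : ∀ k < T, MemLp (x k) 2 P)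
    (h0 : ∀ k < T, P[x k|F k] =ᵐ[P] fun _ => 0)
    (hK : ∀ k < T, ∫ ω, x k ω ^ 2 ∂P ≤ K) (n : ℕ) (hn : n ≤ T) :
    StronglyMeasurable[F n] (fun ω => ∑ k ∈ Finset.range n, x k ω) ∧
    MemLp (fun ω => ∑ k ∈ Finset.range n, x k ω) 2 P ∧
    ∫ ω, (∑ k ∈ Finset.range n, x k ω) ^ 2 ∂P ≤ n * K := by
  induction n with
  | zero =>
    refine ⟨?_, ?_, ?_⟩
    · simpa using stronglyMeasurable_const
    · simp
    · simp
  | succ n ih =>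
    obtain ⟨i1, i2, i3⟩ := ih (by omega)
    have hnT : n < T := by omega
    simp only [Finset.sum_range_succ]
    refine ⟨(i1.mono (F.mono (Nat.le_succ n))).add (hx n hnT), i2.add (h2 n hnT), ?_⟩
    have hIntg : Integrable ((fun ω => ∑ k ∈ Finset.range n, x k ω) * x n) P :=
      i2.integrable_mul (h2 n hnT)
    have hz := integral_mul_zero (F.le n) P ((h2 n hnT).integrable (by norm_num)) (h0 n hnT) i1 hIntg
    have e : ∀ ω, (∑ k ∈ Finset.range n, x k ω + x n ω) ^ 2 =
      ((∑ k ∈ Finset.range n, x k ω) ^ 2 + 2 * ((∑ k ∈ Finset.range n, x k ω) * x n ω))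
        + x n ω ^ 2 := fun ω => by ring
    simp only [e]
    have j2 : Integrable (fun ω => 2 * ((∑ k ∈ Finset.range n, x k ω) * x n ω)) P :=
      hIntg.const_mul 2
    have j3 : Integrable (fun ω => (∑ k ∈ Finset.range n, x k ω) ^ 2
      + 2 * ((∑ k ∈ Finset.range n, x k ω) * x n ω)) P := i2.integrable_sq.add j2
    rw [integral_add j3 (h2 n hnT).integrable_sq,
      integral_add i2.integrable_sq j2, integral_const_mul, hz]
    have := hK n hnT
    rw [Nat.cast_succ]
    linarith

lemma exp_neg_bound (y : ℝ) (hy : 0 ≤ y) : |1 - y - Real.exp (-y)| ≤ y ^ 2 := by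
  have h1 := Real.add_one_le_exp (-y)
  have h2 : Real.exp (-y) ≤ 1 - y + y ^ 2 := by
    have h3 := Real.add_one_le_exp y
    have h4 : Real.exp (-y) * Real.exp y = 1 := by rw [← Real.exp_add]; simp
    have h5 : 0 < Real.exp (-y) := Real.exp_pos _
    have h6 : Real.exp (-y) * (1 + y) ≤ 1 := by nlinarith
    by_contra hcon
    push Not at hcon
    nlinarith [pow_nonneg hy 3, mul_le_mul_of_nonneg_right hcon.le (by linarith : 0 ≤ 1 + y)]
  rw [abs_le]; constructor <;> nlinarith [sq_nonneg y]

lemma exp_I_bound (x : ℝ) :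
    ‖Complex.exp (x * Complex.I) - (1 + x * Complex.I - (x : ℂ) ^ 2 / 2)‖ ≤ 4 * |x| ^ 3 := by
  by_cases hx : |x| ≤ 1
  · have hn : ‖(x : ℂ) * Complex.I‖ = |x| := by simp
    have h := Complex.exp_bound (x := (x : ℂ) * Complex.I) (by rw [hn]; exact hx) (n := 3)
      (by norm_num)
    rw [hn] at h
    have e : ∑ m ∈ Finset.range 3, ((x : ℂ) * Complex.I) ^ m / (m.factorial : ℂ)
        = 1 + x * Complex.I - (x : ℂ) ^ 2 / 2 := by
      simp [Finset.sum_range_succ, Nat.factorial, mul_pow]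
      ring
    rw [e] at h
    refine h.trans ?_
    have : (0:ℝ) ≤ |x| ^ 3 := by positivity
    norm_num [Nat.factorial]
    nlinarith
  · push Not at hx
    have h1 : ‖Complex.exp (x * Complex.I)‖ = 1 := Complex.norm_exp_ofReal_mul_I x
    have h2 : ‖(1 : ℂ) + x * Complex.I - (x : ℂ) ^ 2 / 2‖ ≤ 1 + |x| + |x| ^ 2 / 2 := by
      refine (norm_sub_le _ _).trans ?_
      refine add_le_add ((norm_add_le _ _).trans ?_) ?_
      · simp
      · simp
    refine (norm_sub_le _ _).trans ?_
    rw [h1]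
    have h3 : |x| ≤ |x| ^ 3 := by nlinarith [sq_nonneg (|x| - 1), mul_pos (by linarith : 0 < |x|) (by linarith : 0 < |x| - 1)]
    have h4 : |x| ^ 2 ≤ |x| ^ 3 := by nlinarith [sq_nonneg (|x|)]
    nlinarith

lemma mclt_bound {Ω' : Type*} {mΩ : MeasurableSpace Ω'} (P : Measure Ω')
    [IsProbabilityMeasure P] (F : Filtration ℕ mΩ) (x : ℕ → Ω' → ℝ) (v : ℕ → ℝ) (K L s : ℝ) (T : ℕ)
    (hx : ∀ k < T, StronglyMeasurable[F (k + 1)] (x k))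
    (h1 : ∀ k < T, Integrable (x k) P)
    (h2 : ∀ k < T, Integrable (fun ω => x k ω ^ 2) P)
    (h3 : ∀ k < T, Integrable (fun ω => |x k ω| ^ 3) P)
    (h0 : ∀ k < T, P[x k|F k] =ᵐ[P] fun _ => 0)
    (hv : ∀ k < T, P[fun ω => x k ω ^ 2|F k] =ᵐ[P] fun _ => v k)
    (hv0 : ∀ k < T, 0 ≤ v k) (hvL : ∀ k < T, v k ≤ L)
    (hK : ∀ k < T, ∫ ω, |x k ω| ^ 3 ∂P ≤ K) (n : ℕ) (hn : n ≤ T) :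
    StronglyMeasurable[F n] (fun ω => ∑ k ∈ Finset.range n, x k ω) ∧
    ‖∫ ω, Complex.exp (((s * ∑ k ∈ Finset.range n, x k ω : ℝ) : ℂ) * Complex.I) ∂P
      - ((Real.exp (-(s ^ 2 / 2 * ∑ k ∈ Finset.range n, v k)) : ℝ) : ℂ)‖
      ≤ n * (4 * |s| ^ 3 * K + (s ^ 2 / 2 * L) ^ 2) := by
  induction n with
  | zero =>
    refine ⟨by simpa using stronglyMeasurable_const, by simp⟩
  | succ n ih =>
    obtain ⟨i1, i2⟩ := ih (by omega)
    have hnT : n < T := by omega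
    simp only [Finset.sum_range_succ]
    refine ⟨(i1.mono (F.mono (Nat.le_succ n))).add (hx n hnT), ?_⟩
    set g : Ω' → ℂ := fun ω => Complex.exp (((s * ∑ k ∈ Finset.range n, x k ω : ℝ) : ℂ) * Complex.I)
      with hg
    have hgm : StronglyMeasurable[F n] g := by
      refine Continuous.comp_stronglyMeasurable
        (g := fun y : ℝ => Complex.exp (((s * y : ℝ) : ℂ) * Complex.I)) (by fun_prop) i1
    have hgb : ∀ ω, ‖g ω‖ = 1 := fun ω => Complex.norm_exp_ofReal_mul_I _
    have hgm' : AEStronglyMeasurable g P := (hgm.mono (F.le n)).aestronglyMeasurable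
    have hgi : Integrable g P :=
      Integrable.mono' (integrable_const (1:ℝ)) hgm' (Eventually.of_forall fun ω => (hgb ω).le)
    set R : Ω' → ℂ := fun ω => Complex.exp (((s * x n ω : ℝ) : ℂ) * Complex.I)
      - (1 + ((s * x n ω : ℝ) : ℂ) * Complex.I - ((s * x n ω : ℝ) : ℂ) ^ 2 / 2) with hR
    have hxm : StronglyMeasurable (x n) := (hx n hnT).mono (F.le _)
    have hRm : AEStronglyMeasurable R P := by
      refine StronglyMeasurable.aestronglyMeasurable ?_
      exact Continuous.comp_stronglyMeasurable
        (g := fun y : ℝ => Complex.exp (((s * y : ℝ) : ℂ) * Complex.I)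
      - (1 + ((s * y : ℝ) : ℂ) * Complex.I - ((s * y : ℝ) : ℂ) ^ 2 / 2)) (by fun_prop) hxm
    have hRb : ∀ ω, ‖g ω * R ω‖ ≤ 4 * |s| ^ 3 * |x n ω| ^ 3 := by
      intro ω
      rw [norm_mul, hgb, one_mul]
      refine (exp_I_bound _).trans (le_of_eq ?_)
      rw [abs_mul]; ring
    have hRi : Integrable (fun ω => g ω * R ω) P :=
      Integrable.mono' ((h3 n hnT).const_mul _) (hgm'.mul hRm) (Eventually.of_forall hRb)
    have hb1 : Integrable (fun ω => g ω * ((x n ω : ℝ) : ℂ)) P :=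
      (h1 n hnT).ofReal.bdd_mul hgm' (Eventually.of_forall fun ω => (hgb ω).le)
    have hb2 : Integrable (fun ω => g ω * ((x n ω ^ 2 : ℝ) : ℂ)) P :=
      (h2 n hnT).ofReal.bdd_mul hgm' (Eventually.of_forall fun ω => (hgb ω).le)
    have hp1 := integral_pull (F.le n) P (h1 n hnT) (h0 n hnT) hgm (fun ω => (hgb ω).le)
    have hp2 := integral_pull (F.le n) P (h2 n hnT) (hv n hnT) hgm (fun ω => (hgb ω).le)
    have e : ∀ ω, Complex.exp (((s * (∑ k ∈ Finset.range n, x k ω + x n ω) : ℝ) : ℂ) * Complex.I)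
        = (g ω + (s * Complex.I) * (g ω * ((x n ω : ℝ) : ℂ))
          + (-(s : ℂ) ^ 2 / 2) * (g ω * ((x n ω ^ 2 : ℝ) : ℂ))) + g ω * R ω := by
      intro ω
      have : Complex.exp (((s * (∑ k ∈ Finset.range n, x k ω + x n ω) : ℝ) : ℂ) * Complex.I)
        = g ω * Complex.exp (((s * x n ω : ℝ) : ℂ) * Complex.I) := by
        rw [hg, ← Complex.exp_add]; congr 1; push_cast; ring
      rw [this, hR]; push_cast; ring
    have eI : ∫ ω, Complex.exp
        (((s * (∑ k ∈ Finset.range n, x k ω + x n ω) : ℝ) : ℂ) * Complex.I) ∂P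
        = (1 - s ^ 2 / 2 * v n : ℝ) * ∫ ω, g ω ∂P + ∫ ω, g ω * R ω ∂P := by
      simp only [e]
      have j1 : Integrable (fun ω => (s * Complex.I) * (g ω * ((x n ω : ℝ) : ℂ))) P :=
        hb1.const_mul _
      have j2 : Integrable (fun ω => (-(s : ℂ) ^ 2 / 2) * (g ω * ((x n ω ^ 2 : ℝ) : ℂ))) P :=
        hb2.const_mul _
      have j3 : Integrable (fun ω => g ω + (s * Complex.I) * (g ω * ((x n ω : ℝ) : ℂ))) P :=
        hgi.add j1
      have j4 : Integrable (fun ω => g ω + (s * Complex.I) * (g ω * ((x n ω : ℝ) : ℂ))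
          + (-(s : ℂ) ^ 2 / 2) * (g ω * ((x n ω ^ 2 : ℝ) : ℂ))) P := j3.add j2
      rw [integral_add j4 hRi, integral_add j3 j2, integral_add hgi j1, integral_const_mul, integral_const_mul, hp1, hp2]
      push_cast; ring
    have hR2 : ‖∫ ω, g ω * R ω ∂P‖ ≤ 4 * |s| ^ 3 * K := by
      refine (norm_integral_le_of_norm_le ((h3 n hnT).const_mul _)
        (Eventually.of_forall hRb)).trans ?_
      rw [integral_const_mul]
      exact mul_le_mul_of_nonneg_left (hK n hnT) (by positivity)
    have hG : ‖∫ ω, g ω ∂P‖ ≤ 1 := by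
      refine (norm_integral_le_of_norm_le (integrable_const (1:ℝ))
        (Eventually.of_forall fun ω => (hgb ω).le)).trans ?_
      simp
    set y : ℝ := s ^ 2 / 2 * v n with hy
    have hy0 : 0 ≤ y := mul_nonneg (by positivity) (hv0 n hnT)
    have hyL : y ≤ s ^ 2 / 2 * L := mul_le_mul_of_nonneg_left (hvL n hnT) (by positivity)
    have hE : Real.exp (-(s ^ 2 / 2 * (∑ k ∈ Finset.range n, v k + v n)))
        = Real.exp (-y) * Real.exp (-(s ^ 2 / 2 * ∑ k ∈ Finset.range n, v k)) := by
      rw [← Real.exp_add]; congr 1; rw [hy]; ring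
    rw [eI, hE]
    set W := ∫ ω, g ω ∂P
    set B := Real.exp (-(s ^ 2 / 2 * ∑ k ∈ Finset.range n, v k))
    have hdec : ((1 - y : ℝ) : ℂ) * W + ∫ ω, g ω * R ω ∂P - ((Real.exp (-y) * B : ℝ) : ℂ)
        = (Real.exp (-y) : ℝ) * (W - (B : ℂ)) + ((1 - y - Real.exp (-y) : ℝ) : ℂ) * W
          + ∫ ω, g ω * R ω ∂P := by push_cast; ring
    rw [hdec]
    refine (norm_add₃_le).trans ?_
    have t1 : ‖((Real.exp (-y) : ℝ) : ℂ) * (W - (B : ℂ))‖ ≤ ‖W - (B : ℂ)‖ := by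
      rw [norm_mul, Complex.norm_real, Real.norm_eq_abs, abs_of_pos (Real.exp_pos _)]
      refine mul_le_of_le_one_left (norm_nonneg _) ?_
      rw [Real.exp_le_one_iff]; linarith
    have t2 : ‖((1 - y - Real.exp (-y) : ℝ) : ℂ) * W‖ ≤ (s ^ 2 / 2 * L) ^ 2 := by
      rw [norm_mul, Complex.norm_real, Real.norm_eq_abs]
      calc _ ≤ y ^ 2 * 1 := mul_le_mul (exp_neg_bound y hy0) hG (norm_nonneg _) (by positivity)
        _ ≤ _ := by rw [mul_one]; exact pow_le_pow_left₀ hy0 hyL 2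
    rw [Nat.cast_succ]
    linarith

lemma condExp_lin {Ω' ι : Type*} [Fintype ι] {m mΩ : MeasurableSpace Ω'} (P : Measure Ω')
    [IsProbabilityMeasure P] (c : ι → ℝ) (f : ι → Ω' → ℝ) (w : ι → ℝ)
    (hf : ∀ i, Integrable (f i) P) (hc : ∀ i, P[f i|m] =ᵐ[P] fun _ => w i) :
    P[fun ω => ∑ i, c i * f i ω|m] =ᵐ[P] fun _ => ∑ i, c i * w i := by
  have h1 := condExp_finsetSum (μ := P) (s := Finset.univ) (f := fun i => c i • f i)
    (fun i _ => (hf i).smul (c i)) m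
  have h2 : ∀ i, P[c i • f i|m] =ᵐ[P] fun _ => c i * w i := by
    intro i
    refine (condExp_smul (c i) (f i) m).trans ?_
    filter_upwards [hc i] with ω hω
    simp [hω]
  have h3 : ∀ᵐ ω ∂P, ∀ i, (P[c i • f i|m]) ω = c i * w i := by
    rw [ae_all_iff]; exact h2
  have e : (fun ω => ∑ i, c i * f i ω) = ∑ i, c i • f i := by
    ext ω; simp
  rw [e]
  refine h1.trans ?_
  filter_upwards [h3] with ω hω
  simp [Finset.sum_apply, hω]

/-- Quadratic form. -/
def QF {d : ℕ} (a : Fin d × Fin d → ℝ) (e : Fin d → ℝ) : ℝ := ∑ p, a p * (e p.1 * e p.2)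

/-- Hypotheses on the innovations used in the proofs. -/
structure EpsHyp {d : ℕ} {Ω' : Type*} {mΩ : MeasurableSpace Ω'} (P : Measure Ω')
    (F : Filtration ℕ mΩ) (ε : ℕ → Ω' → Fin d → ℝ) (M : Matrix (Fin d × Fin d) (Fin d × Fin d) ℝ)
    (H : ℕ → Ω' → ℝ) (C : ℝ) : Prop where
  adapted : ∀ t, Measurable[F t] (ε t)
  cov : ∀ t i j, P[fun ω => ε (t + 1) ω i * ε (t + 1) ω j|F t]
        =ᵐ[P] fun _ => if i = j then (1 : ℝ) else 0
  four : ∀ t, ∀ p q : Fin d × Fin d,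
      P[fun ω => ε (t + 1) ω p.1 * ε (t + 1) ω q.1 * (ε (t + 1) ω p.2 * ε (t + 1) ω q.2)|F t]
        =ᵐ[P] fun _ => M p q
  Hint : ∀ t, Integrable (H t) P
  HC : ∀ t, ∫ ω, H t ω ∂P ≤ C
  dom : ∀ t ω, ∀ k ≤ 4, (∑ i, ε t ω i ^ 2) ^ k ≤ H t ω

lemma prod_le_nsq {d : ℕ} (e : Fin d → ℝ) (i j : Fin d) : |e i * e j| ≤ ∑ i, e i ^ 2 := by
  have h : ∀ i, e i ^ 2 ≤ ∑ i, e i ^ 2 := fun i =>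
    Finset.single_le_sum (f := fun i => e i ^ 2) (fun _ _ => sq_nonneg _) (Finset.mem_univ i)
  rw [abs_mul]
  nlinarith [h i, h j, sq_nonneg (|e i| - |e j|), sq_abs (e i), sq_abs (e j)]

lemma QF_le {d : ℕ} {a : Fin d × Fin d → ℝ} {A : ℝ} (ha : ∀ p, |a p| ≤ A) (hA : 0 ≤ A)
    (e : Fin d → ℝ) : |QF a e| ≤ (A * d ^ 2) * ∑ i, e i ^ 2 := by
  refine (Finset.abs_sum_le_sum_abs _ _).trans ?_
  refine (Finset.sum_le_sum (g := fun _ => A * ∑ i, e i ^ 2) fun p _ => ?_).trans ?_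
  · rw [abs_mul]
    exact mul_le_mul (ha p) (prod_le_nsq e _ _) (abs_nonneg _) hA
  · simp [Fintype.card_prod]
    apply le_of_eq; ring

namespace EpsHyp
variable {d : ℕ} {Ω' : Type*} {mΩ : MeasurableSpace Ω'} {P : Measure Ω'} [IsProbabilityMeasure P]
    {F : Filtration ℕ mΩ} {ε : ℕ → Ω' → Fin d → ℝ}
    {M : Matrix (Fin d × Fin d) (Fin d × Fin d) ℝ}
    {H : ℕ → Ω' → ℝ} {C : ℝ}

lemma coord (h : EpsHyp P F ε M H C) (t : ℕ) (i : Fin d) : Measurable[F t] (fun ω => ε t ω i) :=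
  (measurable_pi_apply i).comp (h.adapted t)

lemma QF_meas (h : EpsHyp P F ε M H C) (t : ℕ) (a : Fin d × Fin d → ℝ) :
    Measurable[F t] (fun ω => QF a (ε t ω)) := by
  unfold QF
  refine Finset.measurable_sum _ fun p _ => ?_
  exact ((h.coord t p.1).mul (h.coord t p.2)).const_mul _

lemma QF_pow (h : EpsHyp P F ε M H C) (t : ℕ) {a : Fin d × Fin d → ℝ} {A : ℝ}
    (ha : ∀ p, |a p| ≤ A) (hA : 0 ≤ A) (k : ℕ) (hk : k ≤ 4) :
    Integrable (fun ω => |QF a (ε t ω)| ^ k) P ∧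
      ∫ ω, |QF a (ε t ω)| ^ k ∂P ≤ (A * d ^ 2) ^ k * C := by
  have hb : ∀ ω, |QF a (ε t ω)| ^ k ≤ (A * d ^ 2) ^ k * H t ω := by
    intro ω
    refine (pow_le_pow_left₀ (abs_nonneg _) (QF_le ha hA _) k).trans ?_
    rw [mul_pow]
    exact mul_le_mul_of_nonneg_left (h.dom t ω k hk) (by positivity)
  have hi : Integrable (fun ω => (A * d ^ 2) ^ k * H t ω) P := (h.Hint t).const_mul _
  have hm : Measurable (fun ω => QF a (ε t ω)) := (h.QF_meas t a).mono (F.le t) le_rfl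
  have hI : Integrable (fun ω => |QF a (ε t ω)| ^ k) P := by
    refine Integrable.mono' hi ?_ ?_
    · exact (Measurable.pow_const (by simpa using hm.norm) k).aestronglyMeasurable
    · refine Eventually.of_forall fun ω => ?_
      rw [Real.norm_eq_abs, abs_of_nonneg (by positivity)]
      exact hb ω
  refine ⟨hI, (integral_mono hI hi hb).trans ?_⟩
  rw [integral_const_mul]
  exact mul_le_mul_of_nonneg_left (h.HC t) (by positivity)

lemma pair_int (h : EpsHyp P F ε M H C) (t : ℕ) (i j : Fin d) :
    Integrable (fun ω => ε t ω i * ε t ω j) P := by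
  refine Integrable.mono' (h.Hint t) ?_ (Eventually.of_forall fun ω => ?_)
  · exact (((h.coord t i).mul (h.coord t j)).mono (F.le t) le_rfl).aestronglyMeasurable
  · have := h.dom t ω 1 (by norm_num)
    rw [pow_one] at this
    exact (prod_le_nsq _ _ _).trans this

lemma four_int (h : EpsHyp P F ε M H C) (t : ℕ) (i j k l : Fin d) :
    Integrable (fun ω => ε t ω i * ε t ω j * (ε t ω k * ε t ω l)) P := by
  refine Integrable.mono' (h.Hint t) ?_ (Eventually.of_forall fun ω => ?_)
  · exact ((((h.coord t i).mul (h.coord t j)).mul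
      ((h.coord t k).mul (h.coord t l))).mono (F.le t) le_rfl).aestronglyMeasurable
  · have := h.dom t ω 2 (by norm_num)
    rw [Real.norm_eq_abs, abs_mul]
    refine le_trans ?_ this
    rw [pow_two]
    exact mul_le_mul (prod_le_nsq _ _ _) (prod_le_nsq _ _ _) (abs_nonneg _)
      (Finset.sum_nonneg fun _ _ => sq_nonneg _)

lemma QF_cond (h : EpsHyp P F ε M H C) (t : ℕ) (a : Fin d × Fin d → ℝ) :
    P[fun ω => QF a (ε (t + 1) ω)|F t] =ᵐ[P] fun _ => ∑ i, a (i, i) := by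
  have := condExp_lin (m := F t) P a (fun p ω => ε (t + 1) ω p.1 * ε (t + 1) ω p.2)
    (fun p => if p.1 = p.2 then 1 else 0) (fun p => h.pair_int _ _ _) (fun p => h.cov t p.1 p.2)
  refine this.trans (Eventually.of_forall fun ω => ?_)
  simp [Fintype.sum_prod_type]

/-- The conditional second moment of the quadratic form. -/
lemma QF_cond2 (h : EpsHyp P F ε M H C) (t : ℕ) (a : Fin d × Fin d → ℝ) :
    P[fun ω => QF a (ε (t + 1) ω) ^ 2|F t] =ᵐ[P] fun _ => ∑ p, ∑ q, a p * a q * M p q := by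
  have := condExp_lin (m := F t) P
    (fun pq : (Fin d × Fin d) × (Fin d × Fin d) => a pq.1 * a pq.2)
    (fun pq ω => ε (t + 1) ω pq.1.1 * ε (t + 1) ω pq.2.1 *
      (ε (t + 1) ω pq.1.2 * ε (t + 1) ω pq.2.2))
    (fun pq => M pq.1 pq.2) (fun p => h.four_int _ _ _ _ _) (fun p => h.four t p.1 p.2)
  have e : (fun ω => QF a (ε (t + 1) ω) ^ 2) = fun ω =>
      ∑ pq : (Fin d × Fin d) × (Fin d × Fin d), a pq.1 * a pq.2 *
        (ε (t + 1) ω pq.1.1 * ε (t + 1) ω pq.2.1 *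
      (ε (t + 1) ω pq.1.2 * ε (t + 1) ω pq.2.2)) := by
    ext ω
    rw [Fintype.sum_prod_type, pow_two, QF, Finset.sum_mul_sum]
    refine Finset.sum_congr rfl fun p _ => Finset.sum_congr rfl fun q _ => by ring
  rw [e]
  refine this.trans (Eventually.of_forall fun ω => ?_)
  simp only [Fintype.sum_prod_type (α₁ := Fin d × Fin d) (α₂ := Fin d × Fin d)]

lemma V_nonneg (h : EpsHyp P F ε M H C) (a : Fin d × Fin d → ℝ) :
    0 ≤ ∑ p, ∑ q, a p * a q * M p q := by
  have h1 := h.QF_cond2 0 a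
  have h2 := integral_condExp (μ := P) (F.le 0) (f := fun ω => QF a (ε (0 + 1) ω) ^ 2)
  rw [integral_congr_ae h1] at h2
  simp only [integral_const, probReal_univ, one_smul] at h2
  rw [h2]
  exact integral_nonneg fun ω => sq_nonneg _

lemma M_symm (h : EpsHyp P F ε M H C) (p q : Fin d × Fin d) : M p q = M q p := by
  have h1 : ∀ p q, M p q =
      ∫ ω, ε (0 + 1) ω p.1 * ε (0 + 1) ω q.1 * (ε (0 + 1) ω p.2 * ε (0 + 1) ω q.2) ∂P := by
    intro p q
    rw [← integral_condExp (F.le 0), integral_congr_ae (h.four 0 p q)]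
    simp
  rw [h1, h1]
  congr 1; ext ω; ring

/-- Law of large numbers for triangular arrays of quadratic forms. -/
lemma lln (h : EpsHyp P F ε M H C) (a : ℕ → ℕ → Fin d × Fin d → ℝ) {A L : ℝ}
    (ha : ∀ T, ∀ t < T, ∀ p, |a T t p| ≤ A) (hA : 0 ≤ A)
    (hL : Tendsto (fun T : ℕ => (T : ℝ)⁻¹ * ∑ k ∈ Finset.range T, ∑ i, a T k (i, i)) atTop (𝓝 L)) :
    TendstoInMeasure P (fun (T : ℕ) ω => (T : ℝ)⁻¹ * ∑ k ∈ Finset.range T, QF (a T k) (ε (k + 1) ω))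
      atTop (fun _ => L) := by
  set x : ℕ → ℕ → Ω' → ℝ := fun T k ω => QF (a T k) (ε (k + 1) ω) - ∑ i, a T k (i, i) with hx
  have htr : ∀ T, ∀ k < T, |∑ i, a T k (i, i)| ≤ d * A := by
    intro T k hk
    refine (Finset.abs_sum_le_sum_abs _ _).trans ?_
    refine (Finset.sum_le_sum (g := fun _ => A) fun i _ => ha T k hk _).trans ?_
    simp
  have hQm : ∀ k b, Measurable (fun ω => QF b (ε k ω)) := fun k b =>
    (h.QF_meas k b).mono (F.le k) le_rfl
  have hQ2 : ∀ T, ∀ k < T, MemLp (fun ω => QF (a T k) (ε (k + 1) ω)) 2 P := by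
    intro T k hk
    rw [memLp_two_iff_integrable_sq (hQm _ _).aestronglyMeasurable]
    simpa using (h.QF_pow (k + 1) (ha T k hk) hA 2 (by norm_num)).1
  have hx2 : ∀ T, ∀ k < T, MemLp (x T k) 2 P := fun T k hk => (hQ2 T k hk).sub (memLp_const _)
  set K : ℝ := 2 * ((A * d ^ 2) ^ 2 * C) + 2 * (d * A) ^ 2
  have hbound : ∀ T : ℕ, ∫ ω, (∑ k ∈ Finset.range T, x T k ω) ^ 2 ∂P ≤ T * K := by
    intro T
    refine (mds_sq_bound P F (x T) K T ?_ (hx2 T) ?_ ?_ T le_rfl).2.2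
    · intro k hk
      exact ((h.QF_meas (k + 1) (a T k)).sub_const _).stronglyMeasurable
    · intro k hk
      have h1 := condExp_sub (μ := P) ((hQ2 T k hk).integrable (by norm_num))
        (integrable_const (∑ i, a T k (i, i))) (F k)
      have h2 := h.QF_cond k (a T k)
      have e : x T k = (fun ω => QF (a T k) (ε (k + 1) ω)) - fun _ => ∑ i, a T k (i, i) := rfl
      rw [e]
      refine h1.trans ?_
      rw [condExp_const (F.le k)]
      filter_upwards [h2] with ω hω
      simp [hω]
    · intro k hk
      have hq := h.QF_pow (k + 1) (ha T k hk) hA 2 (by norm_num)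
      simp only [sq_abs] at hq
      calc ∫ ω, x T k ω ^ 2 ∂P ≤ ∫ ω, (2 * QF (a T k) (ε (k + 1) ω) ^ 2 + 2 * (d * A) ^ 2) ∂P := by
            refine integral_mono (hx2 T k hk).integrable_sq
              ((hq.1.const_mul 2).add (integrable_const _)) fun ω => ?_
            have h1 := htr T k hk
            have h2 := sq_le_sq' (abs_le.1 h1).1 (abs_le.1 h1).2
            simp only [hx]
            nlinarith [sq_nonneg (QF (a T k) (ε (k + 1) ω) + ∑ i, a T k (i, i))]
        _ ≤ K := by
            rw [integral_add (hq.1.const_mul 2) (integrable_const _), integral_const_mul]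
            simp only [integral_const, probReal_univ, one_smul]
            linarith [hq.2]
  have hzero : TendstoInMeasure P (fun (T : ℕ) ω => (T : ℝ)⁻¹ * ∑ k ∈ Finset.range T, x T k ω)
      atTop (fun _ => 0) := by
    have hmem : ∀ T : ℕ, MemLp (fun ω => (T : ℝ)⁻¹ * ∑ k ∈ Finset.range T, x T k ω) 2 P := by
      intro T
      refine MemLp.const_mul ?_ _
      exact memLp_finsetSum _ fun k hk => hx2 T k (Finset.mem_range.1 hk)
    refine tendstoInMeasure_of_tendsto_eLpNorm (p := 2) (by norm_num)
      (fun T => (hmem T).1) aestronglyMeasurable_const ?_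
    have he : ∀ T : ℕ, eLpNorm ((fun ω => (T : ℝ)⁻¹ * ∑ k ∈ Finset.range T, x T k ω) - fun _ => 0) 2 P
        = ENNReal.ofReal ((∫ ω, ((T : ℝ)⁻¹ * ∑ k ∈ Finset.range T, x T k ω) ^ 2 ∂P) ^ ((2:ℝ)⁻¹)) := by
      intro T
      have e0 : ((fun ω => (T : ℝ)⁻¹ * ∑ k ∈ Finset.range T, x T k ω) - fun _ => (0:ℝ))
        = fun ω => (T : ℝ)⁻¹ * ∑ k ∈ Finset.range T, x T k ω := by ext; simp
      rw [e0, MemLp.eLpNorm_eq_integral_rpow_norm (by norm_num) (by norm_num) (hmem T)]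
      simp [mul_pow]
    simp only [he]
    rw [← ENNReal.ofReal_zero]
    refine ENNReal.tendsto_ofReal ?_
    have hs : Tendsto (fun T : ℕ => ∫ ω, ((T : ℝ)⁻¹ * ∑ k ∈ Finset.range T, x T k ω) ^ 2 ∂P) atTop
        (𝓝 0) := by
      refine squeeze_zero' (g := fun T : ℕ => K * (T : ℝ)⁻¹)
        (Eventually.of_forall fun T => integral_nonneg fun _ => sq_nonneg _) ?_ ?_
      · filter_upwards [eventually_gt_atTop 0] with T hT
        have hT' : (0:ℝ) < T := by exact_mod_cast hT
        simp only [mul_pow]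
        rw [integral_const_mul]
        calc _ ≤ ((T:ℝ)⁻¹) ^ 2 * (T * K) := mul_le_mul_of_nonneg_left (hbound T) (by positivity)
          _ = _ := by field_simp
      · simpa using (tendsto_inv_atTop_nhds_zero_nat (𝕜 := ℝ)).const_mul K
    simpa using hs.rpow_const (p := (2:ℝ)⁻¹) (Or.inr (by norm_num))
  rw [tendstoInMeasure_iff_dist] at hzero ⊢
  intro η hη
  have hz := hzero (η / 2) (by positivity)
  refine tendsto_of_tendsto_of_tendsto_of_le_of_le' tendsto_const_nhds hz
    (Eventually.of_forall fun _ => zero_le) ?_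
  have hev := (Metric.tendsto_nhds.1 hL) (η / 2) (by positivity)
  filter_upwards [hev] with T hT
  refine measure_mono fun ω hω => ?_
  simp only [Set.mem_ofPred_eq, hx, Finset.sum_sub_distrib, Real.dist_eq] at hω hT ⊢
  have e : (T : ℝ)⁻¹ * ∑ k ∈ Finset.range T, QF (a T k) (ε (k + 1) ω) - L
    = ((T : ℝ)⁻¹ * (∑ k ∈ Finset.range T, QF (a T k) (ε (k + 1) ω)
        - ∑ k ∈ Finset.range T, ∑ i, a T k (i, i)) - 0)
      + ((T : ℝ)⁻¹ * ∑ k ∈ Finset.range T, ∑ i, a T k (i, i) - L) := by ring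
  rw [e] at hω
  have := abs_add_le ((T : ℝ)⁻¹ * (∑ k ∈ Finset.range T, QF (a T k) (ε (k + 1) ω)
        - ∑ k ∈ Finset.range T, ∑ i, a T k (i, i)) - 0)
        ((T : ℝ)⁻¹ * ∑ k ∈ Finset.range T, ∑ i, a T k (i, i) - L)
  linarith

/-- CLT for triangular arrays of quadratic forms (characteristic functions). -/
lemma clt (h : EpsHyp P F ε M H C) (a : ℕ → ℕ → Fin d × Fin d → ℝ) {A S : ℝ}
    (ha : ∀ T, ∀ t < T, ∀ p, |a T t p| ≤ A) (hA : 0 ≤ A)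
    (htr : ∀ T, ∀ t < T, ∑ i, a T t (i, i) = 0)
    (hS : Tendsto (fun T : ℕ => (T : ℝ)⁻¹ * ∑ k ∈ Finset.range T,
      ∑ p, ∑ q, a T k p * a T k q * M p q) atTop (𝓝 S)) :
    Tendsto (fun T : ℕ => ∫ ω, Complex.exp ((((Real.sqrt T)⁻¹ *
        ∑ k ∈ Finset.range T, QF (a T k) (ε (k + 1) ω) : ℝ) : ℂ) * Complex.I) ∂P) atTop
      (𝓝 ((Real.exp (-(S / 2)) : ℝ) : ℂ)) := by
  set K := (A * d ^ 2) ^ 3 * C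
  set L := (A * d ^ 2) ^ 2 * C
  have hQm : ∀ k b, Measurable (fun ω => QF b (ε k ω)) := fun k b =>
    (h.QF_meas k b).mono (F.le k) le_rfl
  have hq := fun T k (hk : k < T) j (hj : j ≤ 4) => h.QF_pow (k + 1) (ha T k hk) hA j hj
  have key : ∀ T : ℕ, ‖∫ ω, Complex.exp ((((Real.sqrt T)⁻¹ *
        ∑ k ∈ Finset.range T, QF (a T k) (ε (k + 1) ω) : ℝ) : ℂ) * Complex.I) ∂P -
        ((Real.exp (-((Real.sqrt T)⁻¹ ^ 2 / 2 * ∑ k ∈ Finset.range T,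
          ∑ p, ∑ q, a T k p * a T k q * M p q)) : ℝ) : ℂ)‖ ≤
        T * (4 * |(Real.sqrt T)⁻¹| ^ 3 * K + ((Real.sqrt T)⁻¹ ^ 2 / 2 * L) ^ 2) := by
    intro T
    refine (mclt_bound P F (fun k ω => QF (a T k) (ε (k + 1) ω))
      (fun k => ∑ p, ∑ q, a T k p * a T k q * M p q) K L (Real.sqrt T)⁻¹ T
      (fun k hk => (h.QF_meas _ _).stronglyMeasurable) ?_ ?_ ?_ ?_ ?_ ?_ ?_ ?_ T le_rfl).2
    · intro k hk
      have := (hq T k hk 1 (by norm_num)).1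
      simp only [pow_one] at this
      exact (integrable_norm_iff (hQm _ _).aestronglyMeasurable).1 this
    · intro k hk
      simpa using (hq T k hk 2 (by norm_num)).1
    · intro k hk
      exact (hq T k hk 3 (by norm_num)).1
    · intro k hk
      have := h.QF_cond k (a T k)
      rwa [htr T k hk] at this
    · intro k hk
      exact h.QF_cond2 k (a T k)
    · intro k hk
      exact h.V_nonneg _
    · intro k hk
      have h1 := h.QF_cond2 k (a T k)
      have h2 := integral_condExp (μ := P) (F.le k) (f := fun ω => QF (a T k) (ε (k + 1) ω) ^ 2)
      rw [integral_congr_ae h1] at h2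
      simp only [integral_const, probReal_univ, one_smul] at h2
      rw [h2]
      simpa using (hq T k hk 2 (by norm_num)).2
    · intro k hk
      exact (hq T k hk 3 (by norm_num)).2
  have hsq : ∀ T : ℕ, (Real.sqrt T)⁻¹ ^ 2 = (T : ℝ)⁻¹ := fun T => by
    rw [inv_pow, Real.sq_sqrt (Nat.cast_nonneg T)]
  have hlim2 : Tendsto (fun T : ℕ => ((Real.exp (-((Real.sqrt T)⁻¹ ^ 2 / 2 *
      ∑ k ∈ Finset.range T, ∑ p, ∑ q, a T k p * a T k q * M p q)) : ℝ) : ℂ)) atTop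
      (𝓝 ((Real.exp (-(S / 2)) : ℝ) : ℂ)) := by
    refine (Complex.continuous_ofReal.tendsto _).comp ((Real.continuous_exp.tendsto _).comp ?_)
    refine Tendsto.neg ((hS.div_const 2).congr fun T => ?_)
    rw [hsq]; ring
  have hsT : Tendsto (fun T : ℕ => (Real.sqrt T)⁻¹) atTop (𝓝 0) :=
    tendsto_inv_atTop_zero.comp (Real.tendsto_sqrt_atTop.comp tendsto_natCast_atTop_atTop)
  have herr : Tendsto (fun T : ℕ => (T : ℝ) * (4 * |(Real.sqrt T)⁻¹| ^ 3 * K +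
      ((Real.sqrt T)⁻¹ ^ 2 / 2 * L) ^ 2)) atTop (𝓝 0) := by
    have h1 : Tendsto (fun T : ℕ => 4 * K * (Real.sqrt T)⁻¹ + (L / 2) ^ 2 * (Real.sqrt T)⁻¹ ^ 2)
        atTop (𝓝 0) := by
      simpa using (hsT.const_mul (4 * K)).add ((hsT.pow 2).const_mul ((L / 2) ^ 2))
    refine h1.congr' ?_
    filter_upwards [eventually_gt_atTop 0] with T hT
    have hT' : (0:ℝ) < T := by exact_mod_cast hT
    have hs0 : 0 < Real.sqrt T := Real.sqrt_pos.2 hT'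
    have hTs : (T : ℝ) = Real.sqrt T ^ 2 := (Real.sq_sqrt hT'.le).symm
    rw [abs_of_pos (inv_pos.2 hs0)]
    set s := Real.sqrt T
    rw [hTs]
    field_simp
  have hdiff := squeeze_zero_norm key herr
  simpa using hdiff.add hlim2

end EpsHyp

lemma linalg {J : Type*} [Fintype J] [DecidableEq J] {Ost Om : Matrix J J ℝ}
    (hst : Ost.PosDef) (hOm : Om.PosSemidef) :
    ∃ (lam : J → ℝ) (A : Matrix J J ℝ),
      (hst.posSemidef.sqrt⁻¹ * Om * hst.posSemidef.sqrt⁻¹).charpoly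
        = ∏ j, (Polynomial.X - Polynomial.C (lam j)) ∧
      A * Aᵀ = Om ∧ Aᵀ * Ost⁻¹ * A = diagonal lam := by
  set R := hst.posSemidef.sqrt with hR
  have hUst : ∀ {B : Matrix J J ℝ} (hB : B.IsHermitian),
      (hB.eigenvectorUnitary : Matrix J J ℝ)ᵀ * (hB.eigenvectorUnitary : Matrix J J ℝ) = 1 := by
    intro B hB
    have := (Matrix.mem_unitaryGroup_iff').1 hB.eigenvectorUnitary.2
    simpa [star_eq_conjTranspose] using this
  have hRdef : R = (hst.1.eigenvectorUnitary : Matrix J J ℝ) *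
      diagonal (fun j => Real.sqrt (hst.1.eigenvalues j)) *
      (hst.1.eigenvectorUnitary : Matrix J J ℝ)ᵀ := by
    rw [hR, Matrix.PosSemidef.sqrt]
    rfl
  have hRt : Rᵀ = R := by
    rw [hRdef]; simp [Matrix.transpose_mul, Matrix.mul_assoc]
  have spec : ∀ {B : Matrix J J ℝ} (hB : B.IsHermitian), B =
      (hB.eigenvectorUnitary : Matrix J J ℝ) * diagonal hB.eigenvalues *
      (hB.eigenvectorUnitary : Matrix J J ℝ)ᵀ := by
    intro B hB
    have := hB.spectral_theorem
    rw [Unitary.conjStarAlgAut_apply] at this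
    exact this
  have hRR : R * R = Ost := by
    conv_rhs => rw [spec hst.1]
    rw [hRdef]
    set U := (hst.1.eigenvectorUnitary : Matrix J J ℝ)
    have hU : Uᵀ * U = 1 := hUst hst.1
    calc _ = U * diagonal (fun j => Real.sqrt (hst.1.eigenvalues j)) * (Uᵀ * U) *
          diagonal (fun j => Real.sqrt (hst.1.eigenvalues j)) * Uᵀ := by
            simp only [Matrix.mul_assoc]
      _ = U * (diagonal (fun j => Real.sqrt (hst.1.eigenvalues j)) *
          diagonal (fun j => Real.sqrt (hst.1.eigenvalues j))) * Uᵀ := by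
            rw [hU]; simp only [Matrix.mul_assoc, Matrix.one_mul]
      _ = _ := by
            rw [Matrix.diagonal_mul_diagonal]
            congr 3; ext j
            exact Real.mul_self_sqrt (hst.posSemidef.eigenvalues_nonneg j)
  have hdet : IsUnit R.det := by
    have : R.det * R.det = Ost.det := by rw [← Matrix.det_mul, hRR]
    have h2 := hst.det_pos
    rw [← this] at h2
    exact isUnit_iff_ne_zero.2 fun h0 => by simp [h0] at h2
  have hRi : R⁻¹ᵀ = R⁻¹ := by rw [Matrix.transpose_nonsing_inv, hRt]
  have hB : (R⁻¹ * Om * R⁻¹).PosSemidef := by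
    have := hOm.mul_mul_conjTranspose_same R⁻¹
    rwa [Matrix.conjTranspose_eq_transpose_of_trivial, hRi] at this
  set B := R⁻¹ * Om * R⁻¹ with hBdef
  set U := (hB.1.eigenvectorUnitary : Matrix J J ℝ) with hUdef
  have hU : Uᵀ * U = 1 := hUst hB.1
  set D := diagonal (fun j => Real.sqrt (hB.1.eigenvalues j)) with hD
  have hDt : Dᵀ = D := by simp [hD]
  have hDD : D * D = diagonal hB.1.eigenvalues := by
    rw [hD, Matrix.diagonal_mul_diagonal]
    congr 1; ext j
    exact Real.mul_self_sqrt (hB.eigenvalues_nonneg j)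
  have hOst : Ost⁻¹ = R⁻¹ * R⁻¹ := by rw [← hRR, Matrix.mul_inv_rev]
  refine ⟨hB.1.eigenvalues, R * U * D, ?_, ?_, ?_⟩
  · have := hB.1.charpoly_eq
    simpa using this
  · rw [Matrix.transpose_mul, Matrix.transpose_mul, hDt, hRt]
    calc _ = R * (U * (D * D) * Uᵀ) * R := by simp only [Matrix.mul_assoc]
      _ = R * B * R := by rw [hDD, ← spec hB.1]
      _ = (R * R⁻¹) * Om * (R⁻¹ * R) := by rw [hBdef]; simp only [Matrix.mul_assoc]
      _ = Om := by rw [Matrix.mul_nonsing_inv _ hdet, Matrix.nonsing_inv_mul _ hdet]; simp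
  · rw [Matrix.transpose_mul, Matrix.transpose_mul, hDt, hRt, hOst]
    calc _ = D * Uᵀ * (R * R⁻¹) * (R⁻¹ * R) * U * D := by simp only [Matrix.mul_assoc]
      _ = D * (Uᵀ * U) * D := by
        rw [Matrix.mul_nonsing_inv _ hdet, Matrix.nonsing_inv_mul _ hdet]
        simp only [Matrix.mul_assoc, Matrix.one_mul]
      _ = _ := by rw [hU, Matrix.mul_one, hDD]

/-- Continuous mapping for convergence in measure towards a constant. -/
lemma tim_cont {Ω' ι E : Type*} [Fintype ι] {mΩ : MeasurableSpace Ω'} (P : Measure Ω')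
    [PseudoMetricSpace E] (X : ℕ → Ω' → ι → ℝ) (c : ι → ℝ) (g : (ι → ℝ) → E)
    (hX : ∀ i, TendstoInMeasure P (fun T ω => X T ω i) atTop (fun _ => c i))
    (hg : ContinuousAt g c) :
    TendstoInMeasure P (fun T ω => g (X T ω)) atTop (fun _ => g c) := by
  rw [tendstoInMeasure_iff_dist]
  intro η hη
  obtain ⟨δ, hδ, hgδ⟩ := Metric.continuousAt_iff.1 hg η hη
  have hs : Tendsto (fun T => ∑ i, P {ω | δ ≤ dist (X T ω i) (c i)}) atTop (𝓝 0) := by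
    have : Tendsto (fun T => ∑ i, P {ω | δ ≤ dist (X T ω i) (c i)}) atTop (𝓝 (∑ _i : ι, 0)) := by
      refine tendsto_finsetSum _ fun i _ => ?_
      exact (tendstoInMeasure_iff_dist.1 (hX i)) δ hδ
    simpa using this
  refine tendsto_of_tendsto_of_tendsto_of_le_of_le tendsto_const_nhds hs
    (fun _ => zero_le) fun T => ?_
  refine le_trans (measure_mono ?_) (measure_iUnion_fintype_le P _)
  intro ω hω
  by_contra hcon
  simp only [Set.mem_iUnion, Set.mem_ofPred_eq, not_exists, not_le] at hcon hω
  exact absurd (hgδ ((dist_pi_lt_iff hδ).2 hcon)) (not_lt.2 hω)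

lemma charFun_lin {J : Type*} [Fintype J] [DecidableEq J] (A : Matrix J J ℝ)
    (t : EuclideanSpace ℝ J) :
    charFun ((stdGaussianPi J).map (fun z => WithLp.toLp 2 (A *ᵥ z) : (J → ℝ) → EuclideanSpace ℝ J)) t
      = ((Real.exp (-((t.ofLp ⬝ᵥ (A * Aᵀ) *ᵥ t.ofLp) / 2)) : ℝ) : ℂ) := by
  have h1 := charFun_pi (μ := fun _ : J => gaussianReal 0 1) (WithLp.toLp 2 (Aᵀ *ᵥ t.ofLp))
  simp only [charFun_gaussianReal] at h1
  rw [charFun_apply, integral_map (by fun_prop) (by fun_prop)] at h1 ⊢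
  have e : ∀ z : J → ℝ, inner ℝ (WithLp.toLp 2 (A *ᵥ z) : EuclideanSpace ℝ J) t
      = inner ℝ (WithLp.toLp 2 z : EuclideanSpace ℝ J) (WithLp.toLp 2 (Aᵀ *ᵥ t.ofLp)) := by
    intro z
    rw [EuclideanSpace.inner_eq_star_dotProduct, EuclideanSpace.inner_eq_star_dotProduct]
    simp only [star_trivial]
    rw [Matrix.dotProduct_mulVec, Matrix.mulVec_transpose]
  simp only [e]
  rw [stdGaussianPi, h1, ← Complex.exp_sum]
  have e2 : (t.ofLp ⬝ᵥ (A * Aᵀ) *ᵥ t.ofLp) = ∑ j, (Aᵀ *ᵥ t.ofLp) j ^ 2 := by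
    rw [← Matrix.mulVec_mulVec, Matrix.dotProduct_mulVec, ← Matrix.mulVec_transpose]
    simp [dotProduct, pow_two]
  rw [e2, Complex.ofReal_exp]
  congr 1
  push_cast
  simp [Finset.sum_div]

lemma grid_mem {k T : ℕ} (hk : k < T) : (((k + 1 : ℕ) : ℝ) / T) ∈ Set.Ioc (0 : ℝ) 1 := by
  have hT : (0 : ℝ) < T := by exact_mod_cast (by omega : 0 < T)
  refine ⟨by positivity, ?_⟩
  rw [div_le_one hT]
  exact_mod_cast hk

lemma mkEps {d : ℕ} {Ω' : Type*} {mΩ : MeasurableSpace Ω'} (P : Measure Ω')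
    [IsProbabilityMeasure P] (F : Filtration ℕ mΩ) (ε : ℕ → Ω' → Fin d → ℝ)
    (hadapted : ∀ t, Measurable[F t] (ε t))
    (hcondcov : ∀ t i j,
      P[fun ω => ε (t + 1) ω i * ε (t + 1) ω j|F t]
        =ᵐ[P] fun _ => if i = j then (1 : ℝ) else 0)
    (M : Matrix (Fin d × Fin d) (Fin d × Fin d) ℝ)
    (hcondM : ∀ t, ∀ p q : Fin d × Fin d,
      P[fun ω => ε (t + 1) ω p.1 * ε (t + 1) ω q.1 * (ε (t + 1) ω p.2 * ε (t + 1) ω q.2)|F t]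
        =ᵐ[P] fun _ => M p q)
    (hmom : ∃ m : ℝ, 1 < m ∧ (∀ t, Integrable (fun ω => euclNorm (ε t ω) ^ (8 * m)) P) ∧
      ∃ C : ℝ, ∀ t, ∫ ω, euclNorm (ε t ω) ^ (8 * m) ∂P ≤ C) :
    ∃ H C, EpsHyp P F ε M H C := by
  obtain ⟨m, hm, hi, C, hC⟩ := hmom
  refine ⟨fun t ω => 1 + euclNorm (ε t ω) ^ (8 * m), 1 + C, hadapted, hcondcov, hcondM,
    fun t => (integrable_const 1).add (hi t), fun t => ?_, fun t ω k hk => ?_⟩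
  · rw [integral_add (integrable_const 1) (hi t)]
    simpa using hC t
  · have hnn : 0 ≤ ∑ i, ε t ω i ^ 2 := Finset.sum_nonneg fun _ _ => sq_nonneg _
    set N := euclNorm (ε t ω) with hN
    have hN0 : 0 ≤ N := Real.sqrt_nonneg _
    have e : ∑ i, ε t ω i ^ 2 = N ^ 2 := (Real.sq_sqrt hnn).symm
    rw [e, ← pow_mul]
    by_cases h1 : N ≤ 1
    · have : N ^ (2 * k) ≤ 1 := pow_le_one₀ hN0 h1
      have : 0 ≤ N ^ (8 * m) := Real.rpow_nonneg hN0 _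
      linarith
    · push Not at h1
      have : N ^ (2 * k) ≤ N ^ (8 * m) := by
        rw [← Real.rpow_natCast]
        refine Real.rpow_le_rpow_of_exponent_le h1.le ?_
        have : ((2 * k : ℕ) : ℝ) ≤ 8 := by exact_mod_cast (by omega : 2 * k ≤ 8)
        linarith
      linarith

lemma rn_bound {α β : Type*} [Fintype α] [Fintype β] {G : ℝ → Matrix α β ℝ}
    (hG : ∀ i j, RNice fun r => G r i j) :
    ∃ C : ℝ, 0 ≤ C ∧ ∀ r ∈ Set.Ioc (0 : ℝ) 1, ∀ i j, |G r i j| ≤ C := by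
  choose C hC using fun i j => (hG i j).1
  refine ⟨∑ i, ∑ j, |C i j|, Finset.sum_nonneg fun _ _ => Finset.sum_nonneg fun _ _ => abs_nonneg _,
    fun r hr i j => ?_⟩
  calc |G r i j| ≤ |C i j| := (hC i j r hr).trans (le_abs_self _)
    _ ≤ ∑ j, |C i j| :=
      Finset.single_le_sum (f := fun j => |C i j|) (fun _ _ => abs_nonneg _) (Finset.mem_univ j)
    _ ≤ _ := Finset.single_le_sum (f := fun i => ∑ j, |C i j|)
      (fun _ _ => Finset.sum_nonneg fun _ _ => abs_nonneg _) (Finset.mem_univ i)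

lemma RNice.gram {α β : Type*} [Fintype β] {G : ℝ → Matrix α β ℝ}
    (hG : ∀ i j, RNice fun r => G r i j) (i j : α) : RNice fun r => (G r * (G r)ᵀ) i j := by
  simp only [Matrix.mul_apply, Matrix.transpose_apply]
  exact RNice.sum _ fun k => (hG i k).mul (hG j k)

lemma lln_u {d n : ℕ} {Ω' : Type*} {mΩ : MeasurableSpace Ω'} {P : Measure Ω'}
    [IsProbabilityMeasure P] {F : Filtration ℕ mΩ} {ε : ℕ → Ω' → Fin d → ℝ}
    {M : Matrix (Fin d × Fin d) (Fin d × Fin d) ℝ} {H : ℕ → Ω' → ℝ} {C : ℝ}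
    (h : EpsHyp P F ε M H C) {G : ℝ → Matrix (Fin n) (Fin d) ℝ}
    (hG : ∀ i j, RNice fun r => G r i j) (i j : Fin n) :
    TendstoInMeasure P (fun (T : ℕ) ω => ((T : ℝ)⁻¹ • ∑ t ∈ Finset.Icc 1 T,
      vecMulVec (uVec G ε T t ω) (uVec G ε T t ω)) i j) atTop
      (fun _ => ∫ r in Set.Ioc (0 : ℝ) 1, (G r * (G r)ᵀ) i j) := by
  obtain ⟨K, hK0, hK⟩ := rn_bound hG
  have hR := riemann_tendsto (RNice.gram hG i j)
  simp only [sum_Icc_one] at hR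
  have := h.lln (fun T k p => G (((k + 1 : ℕ) : ℝ) / T) i p.1 * G (((k + 1 : ℕ) : ℝ) / T) j p.2)
    (A := K * K) (L := ∫ r in Set.Ioc (0 : ℝ) 1, (G r * (G r)ᵀ) i j) ?_ (by positivity) ?_
  · convert this using 3 with T ω
    rw [sum_Icc_one, Matrix.smul_apply, Matrix.sum_apply, smul_eq_mul]
    congr 1
    refine Finset.sum_congr rfl fun k _ => ?_
    rw [vecMulVec_apply, uVec, QF, Fintype.sum_prod_type]
    simp only [Matrix.mulVec, dotProduct]
    rw [Finset.sum_mul_sum]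
    exact Finset.sum_congr rfl fun p _ => Finset.sum_congr rfl fun q _ => by ring
  · intro T k hk p
    rw [abs_mul]
    exact mul_le_mul (hK _ (grid_mem hk) _ _) (hK _ (grid_mem hk) _ _) (abs_nonneg _) hK0
  · simpa only [Matrix.mul_apply, Matrix.transpose_apply] using hR

section
variable {d₁ d₂ : ℕ} {Ω' : Type*} {mΩ : MeasurableSpace Ω'} {P : Measure Ω'}
    [IsProbabilityMeasure P] {F : Filtration ℕ mΩ} {ε : ℕ → Ω' → Fin (d₁ + d₂) → ℝ}
    {M : Matrix (Fin (d₁ + d₂) × Fin (d₁ + d₂)) (Fin (d₁ + d₂) × Fin (d₁ + d₂)) ℝ}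
    {H : ℕ → Ω' → ℝ} {C : ℝ}
    {G₁ : ℝ → Matrix (Fin d₁) (Fin (d₁ + d₂)) ℝ}
    {G₂ : ℝ → Matrix (Fin d₂) (Fin (d₁ + d₂)) ℝ}

lemma RNice.OmR (hG₁ : ∀ i j, RNice fun r => G₁ r i j) (hG₂ : ∀ i j, RNice fun r => G₂ r i j)
    (p q : Fin d₂ × Fin d₁) :
    RNice fun r => ((G₂ r ⊗ₖ G₁ r) * M * (G₂ r ⊗ₖ G₁ r)ᵀ) p q := by
  simp only [Matrix.mul_apply, Matrix.transpose_apply, Matrix.kroneckerMap_apply]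
  refine RNice.sum _ fun x => RNice.mul (RNice.sum _ fun y => ?_) ((hG₂ _ _).mul (hG₁ _ _))
  exact RNice.mul ((hG₂ _ _).mul (hG₁ _ _)) (RNice.const _)

lemma quad_eq (K : Matrix (Fin d₂ × Fin d₁) (Fin (d₁ + d₂) × Fin (d₁ + d₂)) ℝ)
    (t : Fin d₂ × Fin d₁ → ℝ) :
    ∑ p, ∑ q, (t ᵥ* K) p * (t ᵥ* K) q * M p q = t ⬝ᵥ (K * M * Kᵀ) *ᵥ t := by
  rw [← Matrix.mulVec_mulVec, ← Matrix.mulVec_mulVec, Matrix.dotProduct_mulVec,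
    Matrix.mulVec_transpose]
  simp only [dotProduct, Matrix.mulVec, Finset.mul_sum]
  exact Finset.sum_congr rfl fun p _ => Finset.sum_congr rfl fun q _ => by ring

lemma quad_integral (hG₁ : ∀ i j, RNice fun r => G₁ r i j) (hG₂ : ∀ i j, RNice fun r => G₂ r i j)
    (t : Fin d₂ × Fin d₁ → ℝ) :
    RNice (fun r => t ⬝ᵥ ((G₂ r ⊗ₖ G₁ r) * M * (G₂ r ⊗ₖ G₁ r)ᵀ) *ᵥ t) ∧
    ∫ r in Set.Ioc (0 : ℝ) 1, t ⬝ᵥ ((G₂ r ⊗ₖ G₁ r) * M * (G₂ r ⊗ₖ G₁ r)ᵀ) *ᵥ t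
      = t ⬝ᵥ (Matrix.of fun p q : Fin d₂ × Fin d₁ =>
        ∫ r in Set.Ioc (0 : ℝ) 1, ((G₂ r ⊗ₖ G₁ r) * M * (G₂ r ⊗ₖ G₁ r)ᵀ) p q) *ᵥ t := by
  have hN := RNice.OmR (M := M) hG₁ hG₂
  set N : ℝ → Matrix (Fin d₂ × Fin d₁) (Fin d₂ × Fin d₁) ℝ :=
    fun r => (G₂ r ⊗ₖ G₁ r) * M * (G₂ r ⊗ₖ G₁ r)ᵀ
  change RNice (fun r => t ⬝ᵥ N r *ᵥ t) ∧ ∫ r in Set.Ioc (0 : ℝ) 1, t ⬝ᵥ N r *ᵥ t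
    = t ⬝ᵥ (Matrix.of fun p q => ∫ r in Set.Ioc (0 : ℝ) 1, N r p q) *ᵥ t
  have hN' : ∀ p q, RNice fun r => N r p q := hN
  simp only [dotProduct, Matrix.mulVec, Matrix.of_apply]
  refine ⟨RNice.sum _ fun p => (RNice.const _).mul (RNice.sum _ fun q =>
    (hN' p q).mul (RNice.const _)), ?_⟩
  rw [integral_finsetSum]
  · refine Finset.sum_congr rfl fun p _ => ?_
    rw [integral_const_mul, integral_finsetSum]
    · congr 1
      refine Finset.sum_congr rfl fun q _ => ?_
      rw [integral_mul_const]
    · exact fun q _ => ((hN' p q).mul (RNice.const _)).integrableOn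
  · exact fun p _ => ((RNice.const _).mul (RNice.sum _ fun q =>
      (hN' p q).mul (RNice.const _))).integrableOn

lemma delta_meas (h : EpsHyp P F ε M H C) (T : ℕ) :
    Measurable (fun ω => deltaStat G₁ G₂ ε T ω) := by
  have hu : ∀ {n : ℕ} (G : ℝ → Matrix (Fin n) (Fin (d₁ + d₂)) ℝ) (t : ℕ) (i : Fin n),
      Measurable fun ω => uVec G ε T t ω i := by
    intro n G t i
    simp only [uVec, Matrix.mulVec, dotProduct]
    exact Finset.measurable_sum _ fun j _ =>
      ((h.coord t j).mono (F.le t) le_rfl).const_mul _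
  refine measurable_pi_lambda _ fun p => ?_
  simp only [deltaStat, Pi.smul_apply, Finset.sum_apply, thetaSeq, smul_eq_mul]
  exact (Finset.measurable_sum _ fun t _ => (hu G₂ t p.1).mul (hu G₁ t p.2)).const_mul _

lemma delta_clt (h : EpsHyp P F ε M H C)
    (hG₁ : ∀ i j, RNice fun r => G₁ r i j) (hG₂ : ∀ i j, RNice fun r => G₂ r i j)
    (hnull : ∀ r ∈ Set.Ioc (0 : ℝ) 1, G₁ r * (G₂ r)ᵀ = 0)
    (A : Matrix (Fin d₂ × Fin d₁) (Fin d₂ × Fin d₁) ℝ)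
    (hA : A * Aᵀ = Matrix.of fun p q : Fin d₂ × Fin d₁ =>
        ∫ r in Set.Ioc (0 : ℝ) 1, ((G₂ r ⊗ₖ G₁ r) * M * (G₂ r ⊗ₖ G₁ r)ᵀ) p q)
    [IsProbabilityMeasure (stdGaussianPi (Fin d₂ × Fin d₁))] :
    MeasureTheory.TendstoInDistribution
      (fun (T : ℕ) ω => (WithLp.toLp 2 (deltaStat G₁ G₂ ε T ω) : EuclideanSpace ℝ (Fin d₂ × Fin d₁)))
      atTop (fun z => (WithLp.toLp 2 (A *ᵥ z) : EuclideanSpace ℝ (Fin d₂ × Fin d₁)))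
      (fun _ => P) (stdGaussianPi (Fin d₂ × Fin d₁)) := by
  have hm : ∀ T, Measurable (fun ω =>
      (WithLp.toLp 2 (deltaStat G₁ G₂ ε T ω) : EuclideanSpace ℝ (Fin d₂ × Fin d₁))) := fun T =>
    (WithLp.measurable_toLp 2 _).comp (delta_meas h T)
  have hmZ : Measurable (fun z => (WithLp.toLp 2 (A *ᵥ z) : EuclideanSpace ℝ (Fin d₂ × Fin d₁))) := by
    fun_prop
  refine ⟨fun T => (hm T).aemeasurable, hmZ.aemeasurable, ?_⟩
  refine ProbabilityMeasure.tendsto_of_tendsto_charFun fun t => ?_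
  simp only [ProbabilityMeasure.coe_mk]
  rw [charFun_lin, hA, ← (quad_integral hG₁ hG₂ t.ofLp).2]
  obtain ⟨K₁, hK₁0, hK₁⟩ := rn_bound hG₁
  obtain ⟨K₂, hK₂0, hK₂⟩ := rn_bound hG₂
  have hR := riemann_tendsto (quad_integral (M := M) hG₁ hG₂ t.ofLp).1
  simp only [sum_Icc_one, ← quad_eq] at hR
  have := h.clt (fun T k => t.ofLp ᵥ* (G₂ (((k + 1 : ℕ) : ℝ) / T) ⊗ₖ G₁ (((k + 1 : ℕ) : ℝ) / T)))
    (A := ∑ p, |t.ofLp p| * (K₂ * K₁)) ?_ (by positivity) ?_ hR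
  · simp only [quad_eq] at this
    refine this.congr fun T => ?_
    rw [charFun_apply, integral_map (hm T).aemeasurable (by fun_prop)]
    refine integral_congr_ae (Eventually.of_forall fun ω => ?_)
    dsimp only
    congr 3
    rw [EuclideanSpace.inner_eq_star_dotProduct]
    simp only [star_trivial, deltaStat]
    rw [dotProduct_smul, smul_eq_mul, sum_Icc_one, dotProduct_sum]
    congr 1
    refine Finset.sum_congr rfl fun k _ => ?_
    simp only [QF, Matrix.vecMul, dotProduct, thetaSeq, uVec, Matrix.mulVec,
      Matrix.kroneckerMap_apply, Finset.sum_mul]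
    rw [Finset.sum_comm]
    refine Finset.sum_congr rfl fun p _ => ?_
    rw [Finset.mul_sum, Fintype.sum_prod_type]
    refine Finset.sum_congr rfl fun x _ => ?_
    rw [Finset.mul_sum, Finset.mul_sum]
    exact Finset.sum_congr rfl fun y _ => by ring
  · intro T k hk p
    refine (Finset.abs_sum_le_sum_abs _ _).trans (Finset.sum_le_sum fun q _ => ?_)
    simp only [Matrix.kroneckerMap_apply]
    rw [abs_mul, abs_mul]
    exact mul_le_mul_of_nonneg_left (mul_le_mul (hK₂ _ (grid_mem hk) _ _) (hK₁ _ (grid_mem hk) _ _)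
      (abs_nonneg _) hK₂0) (abs_nonneg _)
  · intro T k hk
    simp only [Matrix.vecMul, dotProduct, Matrix.kroneckerMap_apply]
    rw [Finset.sum_comm]
    refine Finset.sum_eq_zero fun p _ => ?_
    rw [← Finset.mul_sum]
    have := congrFun (congrFun (hnull _ (grid_mem hk)) p.2) p.1
    simp only [Matrix.mul_apply, Matrix.transpose_apply, Matrix.zero_apply] at this
    simp only [mul_comm (G₂ _ _ _)]
    rw [this, mul_zero]

lemma Om_psd (h : EpsHyp P F ε M H C)
    (hG₁ : ∀ i j, RNice fun r => G₁ r i j) (hG₂ : ∀ i j, RNice fun r => G₂ r i j) :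
    (Matrix.of fun p q : Fin d₂ × Fin d₁ =>
        ∫ r in Set.Ioc (0 : ℝ) 1, ((G₂ r ⊗ₖ G₁ r) * M * (G₂ r ⊗ₖ G₁ r)ᵀ) p q).PosSemidef := by
  refine Matrix.PosSemidef.of_dotProduct_mulVec_nonneg ?_ fun t => ?_
  · ext p q
    simp only [Matrix.conjTranspose_apply, Matrix.of_apply, star_trivial]
    congr 1; ext r
    have hM : Mᵀ = M := by ext p q; exact h.M_symm q p
    have : ((G₂ r ⊗ₖ G₁ r) * M * (G₂ r ⊗ₖ G₁ r)ᵀ)ᵀ = (G₂ r ⊗ₖ G₁ r) * M * (G₂ r ⊗ₖ G₁ r)ᵀ := by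
      rw [Matrix.transpose_mul, Matrix.transpose_mul, hM, Matrix.transpose_transpose,
        Matrix.mul_assoc]
    exact congrFun (congrFun this p) q
  · rw [star_trivial, ← (quad_integral hG₁ hG₂ t).2]
    refine integral_nonneg fun r => ?_
    dsimp only
    rw [← quad_eq]
    exact h.V_nonneg _
end

lemma gram_posDef {n d : ℕ} {G : ℝ → Matrix (Fin n) (Fin d) ℝ}
    (hG : ∀ i j, RNice fun r => G r i j)
    (hpd : ∀ r ∈ Set.Ioc (0 : ℝ) 1, (G r * (G r)ᵀ).PosDef) :
    (Matrix.of fun i j : Fin n => ∫ r in Set.Ioc (0 : ℝ) 1, (G r * (G r)ᵀ) i j).PosDef := by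
  refine Matrix.PosDef.of_dotProduct_mulVec_pos ?_ fun t ht => ?_
  · ext p q
    simp only [Matrix.conjTranspose_apply, Matrix.of_apply, star_trivial]
    congr 1; ext r
    have : (G r * (G r)ᵀ)ᵀ = G r * (G r)ᵀ := by simp [Matrix.transpose_mul]
    exact congrFun (congrFun this p) q
  · have hN := RNice.gram hG
    set N : ℝ → Matrix (Fin n) (Fin n) ℝ := fun r => G r * (G r)ᵀ
    have hN' : ∀ p q, RNice fun r => N r p q := hN
    have hRN : RNice fun r => t ⬝ᵥ N r *ᵥ t := by
      simp only [dotProduct, Matrix.mulVec]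
      exact RNice.sum _ fun p => (RNice.const _).mul (RNice.sum _ fun q =>
        (hN' p q).mul (RNice.const _))
    have e : ∫ r in Set.Ioc (0 : ℝ) 1, t ⬝ᵥ N r *ᵥ t
        = t ⬝ᵥ (Matrix.of fun p q => ∫ r in Set.Ioc (0 : ℝ) 1, N r p q) *ᵥ t := by
      simp only [dotProduct, Matrix.mulVec, Matrix.of_apply]
      rw [integral_finsetSum]
      · refine Finset.sum_congr rfl fun p _ => ?_
        rw [integral_const_mul, integral_finsetSum]
        · congr 1
          refine Finset.sum_congr rfl fun q _ => ?_
          rw [integral_mul_const]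
        · exact fun q _ => ((hN' p q).mul (RNice.const _)).integrableOn
      · exact fun p _ => ((RNice.const _).mul (RNice.sum _ fun q =>
          (hN' p q).mul (RNice.const _))).integrableOn
    have hpos : ∀ r ∈ Set.Ioc (0:ℝ) 1, 0 < t ⬝ᵥ N r *ᵥ t := fun r hr => by
      simpa using (hpd r hr).dotProduct_mulVec_pos ht
    rw [star_trivial]
    change 0 < t ⬝ᵥ (Matrix.of fun p q => ∫ r in Set.Ioc (0 : ℝ) 1, N r p q) *ᵥ t
    rw [← e, setIntegral_pos_iff_support_of_nonneg_ae
      (ae_restrict_of_forall_mem measurableSet_Ioc fun r hr => (hpos r hr).le) hRN.integrableOn]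
    have : Set.Ioc (0:ℝ) 1 ⊆ Function.support (fun r => t ⬝ᵥ N r *ᵥ t) ∩ Set.Ioc (0:ℝ) 1 :=
      fun r hr => ⟨(hpos r hr).ne', hr⟩
    refine lt_of_lt_of_le ?_ (measure_mono this)
    simp

lemma posDef_rows {d₁ d₂ d : ℕ} {A : Matrix (Fin d₁) (Fin d) ℝ} {B : Matrix (Fin d₂) (Fin d) ℝ}
    (h : (Matrix.fromRows A B * (Matrix.fromRows A B)ᵀ).PosDef) :
    (A * Aᵀ).PosDef ∧ (B * Bᵀ).PosDef := by
  constructor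
  · have := h.submatrix (e := (Sum.inl : Fin d₁ → Fin d₁ ⊕ Fin d₂)) Sum.inl_injective
    convert this using 1
    ext i j
    simp [Matrix.mul_apply]
  · have := h.submatrix (e := (Sum.inr : Fin d₂ → Fin d₁ ⊕ Fin d₂)) Sum.inr_injective
    convert this using 1
    ext i j
    simp [Matrix.mul_apply]

/-- The Kronecker product of two matrices whose entries are stored in one vector. -/
def kronOf {m n : ℕ} (x : (Fin m × Fin m) ⊕ (Fin n × Fin n) → ℝ) :
    Matrix (Fin m × Fin n) (Fin m × Fin n) ℝ :=
  (Matrix.of fun i j => x (Sum.inl (i, j))) ⊗ₖ (Matrix.of fun i j => x (Sum.inr (i, j)))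

lemma kronOf_cont {m n : ℕ} : Continuous (kronOf (m := m) (n := n)) := by
  refine continuous_matrix fun p q => ?_
  simp only [kronOf, Matrix.kroneckerMap_apply, Matrix.of_apply]
  fun_prop

/-- Entries of the inverse of `kronOf`. -/
def kronInv {m n : ℕ} (x : (Fin m × Fin m) ⊕ (Fin n × Fin n) → ℝ) :
    (Fin m × Fin n) → (Fin m × Fin n) → ℝ := fun p q => (kronOf x)⁻¹ p q

lemma kronInv_meas {m n : ℕ} : Measurable (kronInv (m := m) (n := n)) := by
  refine measurable_pi_lambda _ fun p => measurable_pi_lambda _ fun q => ?_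
  simp only [kronInv, Matrix.inv_def, Matrix.smul_apply, Ring.inverse_eq_inv, smul_eq_mul]
  exact (kronOf_cont.matrix_det.measurable.inv).mul
    (kronOf_cont.matrix_adjugate.matrix_elem p q).measurable

lemma kronInv_contAt {m n : ℕ} {x : (Fin m × Fin m) ⊕ (Fin n × Fin n) → ℝ}
    (hx : (kronOf x).det ≠ 0) : ContinuousAt kronInv x := by
  refine continuousAt_pi.2 fun p => continuousAt_pi.2 fun q => ?_
  simp only [kronInv, Matrix.inv_def, Matrix.smul_apply, Ring.inverse_eq_inv, smul_eq_mul]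
  exact (kronOf_cont.matrix_det.continuousAt.inv₀ hx).mul
    (kronOf_cont.matrix_adjugate.matrix_elem p q).continuousAt

instance stdGaussianPi_prob (ι : Type*) [Fintype ι] : IsProbabilityMeasure (stdGaussianPi ι) := by
  unfold stdGaussianPi; infer_instance

section
variable {d₁ d₂ : ℕ} {Ω' : Type*} {mΩ : MeasurableSpace Ω'} {P : Measure Ω'}
    [IsProbabilityMeasure P] {F : Filtration ℕ mΩ} {ε : ℕ → Ω' → Fin (d₁ + d₂) → ℝ}
    {M : Matrix (Fin (d₁ + d₂) × Fin (d₁ + d₂)) (Fin (d₁ + d₂) × Fin (d₁ + d₂)) ℝ}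
    {H : ℕ → Ω' → ℝ} {C : ℝ}
    {G₁ : ℝ → Matrix (Fin d₁) (Fin (d₁ + d₂)) ℝ}
    {G₂ : ℝ → Matrix (Fin d₂) (Fin (d₁ + d₂)) ℝ}

lemma cov_meas (h : EpsHyp P F ε M H C) {n : ℕ} (G : ℝ → Matrix (Fin n) (Fin (d₁ + d₂)) ℝ)
    (T : ℕ) (i j : Fin n) :
    Measurable fun ω => ((T : ℝ)⁻¹ • ∑ t ∈ Finset.Icc 1 T,
      vecMulVec (uVec G ε T t ω) (uVec G ε T t ω)) i j := by
  have hu : ∀ (t : ℕ) (i : Fin n), Measurable fun ω => uVec G ε T t ω i := by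
    intro t i
    simp only [uVec, Matrix.mulVec, dotProduct]
    exact Finset.measurable_sum _ fun j _ =>
      ((h.coord t j).mono (F.le t) le_rfl).const_mul _
  simp only [Matrix.smul_apply, Matrix.sum_apply, vecMulVec_apply, smul_eq_mul]
  exact (Finset.measurable_sum _ fun t _ => (hu t i).mul (hu t j)).const_mul _

/-- The entries of the two sample covariance matrices. -/
def covEntries (G₁ : ℝ → Matrix (Fin d₁) (Fin (d₁ + d₂)) ℝ)
    (G₂ : ℝ → Matrix (Fin d₂) (Fin (d₁ + d₂)) ℝ) (ε : ℕ → Ω' → Fin (d₁ + d₂) → ℝ)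
    (T : ℕ) (ω : Ω') : (Fin d₂ × Fin d₂) ⊕ (Fin d₁ × Fin d₁) → ℝ :=
  Sum.elim
    (fun p => ((T : ℝ)⁻¹ • ∑ t ∈ Finset.Icc 1 T,
      vecMulVec (uVec G₂ ε T t ω) (uVec G₂ ε T t ω)) p.1 p.2)
    (fun p => ((T : ℝ)⁻¹ • ∑ t ∈ Finset.Icc 1 T,
      vecMulVec (uVec G₁ ε T t ω) (uVec G₁ ε T t ω)) p.1 p.2)

lemma sst_limit (h : EpsHyp P F ε M H C)
    (hG₁ : ∀ i j, RNice fun r => G₁ r i j) (hG₂ : ∀ i j, RNice fun r => G₂ r i j)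
    (hnull : ∀ r ∈ Set.Ioc (0 : ℝ) 1, G₁ r * (G₂ r)ᵀ = 0)
    (A : Matrix (Fin d₂ × Fin d₁) (Fin d₂ × Fin d₁) ℝ)
    (hA : A * Aᵀ = Matrix.of fun p q : Fin d₂ × Fin d₁ =>
        ∫ r in Set.Ioc (0 : ℝ) 1, ((G₂ r ⊗ₖ G₁ r) * M * (G₂ r ⊗ₖ G₁ r)ᵀ) p q)
    (Ost : Matrix (Fin d₂ × Fin d₁) (Fin d₂ × Fin d₁) ℝ)
    (hOst : Ost = (Matrix.of fun i j : Fin d₂ => ∫ r in Set.Ioc (0 : ℝ) 1, (G₂ r * (G₂ r)ᵀ) i j) ⊗ₖ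
        (Matrix.of fun i j : Fin d₁ => ∫ r in Set.Ioc (0 : ℝ) 1, (G₁ r * (G₁ r)ᵀ) i j))
    (hdet : Ost.det ≠ 0) :
    MeasureTheory.TendstoInDistribution (fun (T : ℕ) ω => Sst G₁ G₂ ε T ω)
      atTop (fun z => (A *ᵥ z) ⬝ᵥ Ost⁻¹ *ᵥ (A *ᵥ z))
      (fun _ => P) (stdGaussianPi (Fin d₂ × Fin d₁)) := by
  let c : (Fin d₂ × Fin d₂) ⊕ (Fin d₁ × Fin d₁) → ℝ := Sum.elim
    (fun p => ∫ r in Set.Ioc (0 : ℝ) 1, (G₂ r * (G₂ r)ᵀ) p.1 p.2)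
    (fun p => ∫ r in Set.Ioc (0 : ℝ) 1, (G₁ r * (G₁ r)ᵀ) p.1 p.2)
  have hc : kronOf c = Ost := by rw [hOst]; rfl
  have hX : ∀ i, TendstoInMeasure P (fun T ω => covEntries G₁ G₂ ε T ω i) atTop (fun _ => c i) := by
    rintro (p | p)
    · exact lln_u h hG₂ p.1 p.2
    · exact lln_u h hG₁ p.1 p.2
  have hY := tim_cont P (covEntries G₁ G₂ ε) c kronInv hX (kronInv_contAt (by rw [hc]; exact hdet))
  have hYm : ∀ T, Measurable fun ω => kronInv (covEntries G₁ G₂ ε T ω) := by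
    intro T
    refine kronInv_meas.comp (measurable_pi_lambda _ ?_)
    rintro (p | p)
    · exact cov_meas h G₂ T p.1 p.2
    · exact cov_meas h G₁ T p.1 p.2
  let g : EuclideanSpace ℝ (Fin d₂ × Fin d₁) × ((Fin d₂ × Fin d₁) → (Fin d₂ × Fin d₁) → ℝ) → ℝ :=
    fun x => ∑ p, x.1 p * ∑ q, x.2 p q * x.1 q
  have hg : Continuous g := by fun_prop
  have key := (delta_clt h hG₁ hG₂ hnull A hA).continuous_comp_prodMk_of_tendstoInMeasure_const
    hg hY (fun T => (hYm T).aemeasurable)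
  have e2 : (fun z => (A *ᵥ z) ⬝ᵥ Ost⁻¹ *ᵥ (A *ᵥ z))
    = fun z => g (WithLp.toLp 2 (A *ᵥ z), kronInv c) := by
    funext z
    rw [← hc]; rfl
  rw [e2]
  exact key
end

theorem statement7
    (d₁ d₂ : ℕ) (hd₁ : 1 ≤ d₁) (hd₂ : 1 ≤ d₂)
    (G₁ : ℝ → Matrix (Fin d₁) (Fin (d₁ + d₂)) ℝ)
    (G₂ : ℝ → Matrix (Fin d₂) (Fin (d₁ + d₂)) ℝ)
    (hG₁bdd : ∃ C : ℝ, ∀ r ∈ Set.Ioc (0 : ℝ) 1, ∀ i j, |G₁ r i j| ≤ C)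
    (hG₂bdd : ∃ C : ℝ, ∀ r ∈ Set.Ioc (0 : ℝ) 1, ∀ i j, |G₂ r i j| ≤ C)
    (hG₁lip : ∀ i j, PiecewiseLipschitz fun r => G₁ r i j)
    (hG₂lip : ∀ i j, PiecewiseLipschitz fun r => G₂ r i j)
    (hposdef : ∀ r ∈ Set.Ioc (0 : ℝ) 1,
      (Matrix.fromRows (G₁ r) (G₂ r) * (Matrix.fromRows (G₁ r) (G₂ r))ᵀ).PosDef)
    (hnull : ∀ r ∈ Set.Ioc (0 : ℝ) 1, G₁ r * (G₂ r)ᵀ = 0)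
    {Ω' : Type*} {mΩ : MeasurableSpace Ω'} (P : Measure Ω') [IsProbabilityMeasure P]
    (F : Filtration ℕ mΩ)
    (ε : ℕ → Ω' → Fin (d₁ + d₂) → ℝ)
    (hmeas : ∀ t, Measurable (ε t))
    (hadapted : ∀ t, Measurable[F t] (ε t))
    (hcondzero : ∀ t, P[ε (t + 1)|F t] =ᵐ[P] 0)
    (hcondcov : ∀ t i j,
      P[fun ω => ε (t + 1) ω i * ε (t + 1) ω j|F t]
        =ᵐ[P] fun _ => if i = j then (1 : ℝ) else 0)
    (M : Matrix (Fin (d₁ + d₂) × Fin (d₁ + d₂)) (Fin (d₁ + d₂) × Fin (d₁ + d₂)) ℝ)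
    (hcondM : ∀ t, ∀ p q : Fin (d₁ + d₂) × Fin (d₁ + d₂),
      P[fun ω => ε (t + 1) ω p.1 * ε (t + 1) ω q.1 * (ε (t + 1) ω p.2 * ε (t + 1) ω q.2)|F t]
        =ᵐ[P] fun _ => M p q)
    (hmom : ∃ m : ℝ, 1 < m ∧ (∀ t, Integrable (fun ω => euclNorm (ε t ω) ^ (8 * m)) P) ∧
      ∃ C : ℝ, ∀ t, ∫ ω, euclNorm (ε t ω) ^ (8 * m) ∂P ≤ C) :
    ∃ hst : ((Matrix.of fun i j : Fin d₂ => ∫ r in Set.Ioc (0 : ℝ) 1, (G₂ r * (G₂ r)ᵀ) i j) ⊗ₖ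
        (Matrix.of fun i j : Fin d₁ => ∫ r in Set.Ioc (0 : ℝ) 1, (G₁ r * (G₁ r)ᵀ) i j)).PosDef,
      ∃ lam : Fin d₂ × Fin d₁ → ℝ,
        ((hst.posSemidef.sqrt⁻¹ *
            (Matrix.of fun p q : Fin d₂ × Fin d₁ =>
              ∫ r in Set.Ioc (0 : ℝ) 1, ((G₂ r ⊗ₖ G₁ r) * M * (G₂ r ⊗ₖ G₁ r)ᵀ) p q) *
            hst.posSemidef.sqrt⁻¹).charpoly
          = ∏ j : Fin d₂ × Fin d₁, (Polynomial.X - Polynomial.C (lam j))) ∧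
        TendstoInDistribution P (Sst G₁ G₂ ε)
          ((stdGaussianPi (Fin d₂ × Fin d₁)).map fun z => ∑ j, lam j * z j ^ 2) := by
  obtain ⟨H, C, h⟩ := mkEps P F ε hadapted hcondcov M hcondM hmom
  have hG₁ : ∀ i j, RNice fun r => G₁ r i j := fun i j =>
    RNice.of_piecewise (hG₁bdd.imp fun _ hC r hr => hC r hr i j) (hG₁lip i j)
  have hG₂ : ∀ i j, RNice fun r => G₂ r i j := fun i j =>
    RNice.of_piecewise (hG₂bdd.imp fun _ hC r hr => hC r hr i j) (hG₂lip i j)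
  have hst := (gram_posDef hG₂ fun r hr => (posDef_rows (hposdef r hr)).2).kronecker
    (gram_posDef hG₁ fun r hr => (posDef_rows (hposdef r hr)).1)
  obtain ⟨lam, A, hchar, hAA, hdiag⟩ := linalg hst (Om_psd h hG₁ hG₂)
  refine ⟨hst, lam, hchar, ?_⟩
  have key := sst_limit h hG₁ hG₂ hnull A hAA _ rfl hst.det_pos.ne'
  have e : ∀ z : Fin d₂ × Fin d₁ → ℝ, ∑ j, lam j * z j ^ 2 = (A *ᵥ z) ⬝ᵥ
      ((Matrix.of fun i j : Fin d₂ => ∫ r in Set.Ioc (0 : ℝ) 1, (G₂ r * (G₂ r)ᵀ) i j) ⊗ₖ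
        (Matrix.of fun i j : Fin d₁ => ∫ r in Set.Ioc (0 : ℝ) 1, (G₁ r * (G₁ r)ᵀ) i j))⁻¹ *ᵥ
      (A *ᵥ z) := by
    intro z
    have : z ⬝ᵥ (diagonal lam) *ᵥ z = ∑ j, lam j * z j ^ 2 := by
      simp only [dotProduct, Matrix.mulVec_diagonal]
      exact Finset.sum_congr rfl fun j _ => by ring
    rw [← this, ← hdiag, ← Matrix.mulVec_mulVec, ← Matrix.mulVec_mulVec, Matrix.dotProduct_mulVec,
      Matrix.vecMul_transpose]
  intro f
  have ht := (ProbabilityMeasure.tendsto_iff_forall_integral_tendsto.1 key.tendsto) f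
  simp only [ProbabilityMeasure.coe_mk] at ht
  simp only [e]
  refine ht.congr fun T => ?_
  exact integral_map (key.forall_aemeasurable T) f.continuous.aestronglyMeasurable

end
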